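/- arXiv:2405.12828 — 2 statements merged into one kernel-verified Lean document; each statement's English description precedes it below -/
import Mathlib

section
/- Let ω be a (p,q) double form on a Euclidean n-space. Then (1/2) g² # ω = 4 g·(c ω) − 4q ω + 4 𝔖̃𝔖 ω, where c is the contraction, 𝔖 the first Bianchi sum and 𝔖̃ its adjoint. -/
noncomputable section

open Finset
open scoped RealInnerProductSpace

/-- Euclidean `n`-space. -/
abbrev Evec (n : ℕ) := EuclideanSpace ℝ (Fin n)

/-- The space of `(p,q)` double forms, modeled as real-valued kernels on pairs of tuples. -/
abbrev DF (n p q : ℕ) := (Fin p → Evec n) → (Fin q → Evec n) → ℝ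

/-- `p`-forms. -/
abbrev Form (n p : ℕ) := (Fin p → Evec n) → ℝ

/-- Mixed-degree forms (elements of the full exterior algebra). -/
abbrev MixedForm (n : ℕ) := ∀ p, Form n p

/-- Mixed-bidegree double forms. -/
abbrev MixedDF (n : ℕ) := ∀ p q, DF n p q

/-- The standard orthonormal basis. -/
def ebasis (n : ℕ) (i : Fin n) : Evec n := EuclideanSpace.single i 1

/-- The metric as a `(1,1)` double form. -/
def gdf (n : ℕ) : DF n 1 1 := fun x y => ⟪x 0, y 0⟫

/-- Alternating multilinear predicate for a `p`-form kernel. -/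
def IsAltML {n m : ℕ} (f : Form n m) : Prop :=
  (∀ (x : Fin m → Evec n) (i : Fin m) (c : ℝ) (a b : Evec n),
      f (Function.update x i (c • a + b)) =
        c * f (Function.update x i a) + f (Function.update x i b)) ∧
  (∀ (x : Fin m → Evec n) (i j : Fin m), i ≠ j → x i = x j → f x = 0)

/-- A kernel is a genuine double form iff it is alternating multilinear in both blocks. -/
def IsDF {n p q : ℕ} (ω : DF n p q) : Prop :=
  (∀ y, IsAltML (n := n) fun x => ω x y) ∧ (∀ x, IsAltML (ω x))

/-- Bilinearity of a function of two vectors. -/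
def IsBilin {n : ℕ} (h : Evec n → Evec n → ℝ) : Prop :=
  (∀ y, IsLinearMap ℝ fun x => h x y) ∧ (∀ x, IsLinearMap ℝ (h x))

/-- A 2-form: an alternating bilinear function. -/
def IsAltBilin {n : ℕ} (h : Evec n → Evec n → ℝ) : Prop :=
  IsBilin h ∧ ∀ x, h x x = 0

/-- Exterior product of double forms. -/
def wedge {n p q r s : ℕ} (ω : DF n p q) (η : DF n r s) : DF n (p + r) (q + s) :=
  fun x y =>
    (((p.factorial * r.factorial * q.factorial * s.factorial : ℕ) : ℝ))⁻¹ *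
      ∑ σ : Equiv.Perm (Fin (p + r)), ∑ τ : Equiv.Perm (Fin (q + s)),
        ((Equiv.Perm.sign σ : ℤ) : ℝ) * ((Equiv.Perm.sign τ : ℤ) : ℝ) *
          ω (fun i => x (σ (Fin.castAdd r i))) (fun j => y (τ (Fin.castAdd s j))) *
          η (fun i => x (σ (Fin.natAdd p i))) (fun j => y (τ (Fin.natAdd q j)))

/-- Exterior powers of the metric: `gᵖ`. -/
def gpow (n : ℕ) : (p : ℕ) → DF n p p
  | 0 => fun _ _ => 1
  | p + 1 => wedge (gpow n p) (gdf n)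

/-- The natural inner product of `(p,q)` double forms. -/
def innerDF {n p q : ℕ} (ω η : DF n p q) : ℝ :=
  (((p.factorial * q.factorial : ℕ) : ℝ))⁻¹ *
    ∑ f : Fin p → Fin n, ∑ h : Fin q → Fin n,
      ω (fun i => ebasis n (f i)) (fun j => ebasis n (h j)) *
        η (fun i => ebasis n (f i)) (fun j => ebasis n (h j))

/-- Composition product of double forms: `comp ω₁ ω₂ = ω₁ ∘ ω₂`. -/
def comp {n p q r : ℕ} (ω₁ : DF n p q) (ω₂ : DF n r p) : DF n r q :=
  fun x y =>
    ((p.factorial : ℝ))⁻¹ *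
      ∑ f : Fin p → Fin n,
        ω₂ x (fun i => ebasis n (f i)) * ω₁ (fun i => ebasis n (f i)) y

/-- Transpose of a double form. -/
def transp {n p q : ℕ} (ω : DF n p q) : DF n q p := fun x y => ω y x

/-- Inclusion of bilinear forms as `(1,1)` double forms (the map `ρ`). -/
def rho {n : ℕ} (h : Evec n → Evec n → ℝ) : DF n 1 1 := fun x y => h (x 0) (y 0)

/-- Inner product of 2-forms. -/
def inner2 {n : ℕ} (α β : Evec n → Evec n → ℝ) : ℝ :=
  (2:ℝ)⁻¹ * ∑ i, ∑ j, α (ebasis n i) (ebasis n j) * β (ebasis n i) (ebasis n j)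

/-- The curvature operator of a `(2,2)` double form, acting on 2-forms. -/
def curvOp {n : ℕ} (R : DF n 2 2) (θ : Evec n → Evec n → ℝ) : Evec n → Evec n → ℝ :=
  fun x y => (2:ℝ)⁻¹ * ∑ i, ∑ j,
    θ (ebasis n i) (ebasis n j) * R ![ebasis n i, ebasis n j] ![x, y]

/-- The first Bianchi identity for a `(2,2)` double form. -/
def FirstBianchi {n : ℕ} (R : DF n 2 2) : Prop :=
  ∀ x y z t : Evec n, R ![x, y] ![z, t] + R ![y, z] ![x, t] + R ![z, x] ![y, t] = 0

/-- The Ricci contraction `c R` of a `(2,2)` double form. -/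
def ricci {n : ℕ} (R : DF n 2 2) : DF n 1 1 :=
  fun x y => ∑ i, R ![ebasis n i, x 0] ![ebasis n i, y 0]

/-- Contraction of double forms. -/
def contr {n p q : ℕ} (ω : DF n (p + 1) (q + 1)) : DF n p q :=
  fun x y => ∑ i, ω (Fin.cons (ebasis n i) x) (Fin.cons (ebasis n i) y)

/-- Iterated contraction `cʳ`. -/
def contrIter {n : ℕ} : (r : ℕ) → {p q : ℕ} → DF n (p + r) (q + r) → DF n p q
  | 0, _, _, ω => ω
  | r + 1, _, _, ω => contrIter r (contr ω)

/-- The `(1,1)` double form associated to an endomorphism. -/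
def hdf {n : ℕ} (h : Evec n →ₗ[ℝ] Evec n) : DF n 1 1 := fun x y => ⟪h (x 0), y 0⟫

/-- Left exterior multiplication of a form by a covector `f`. -/
def wedgeC {n p : ℕ} (f : Evec n → ℝ) (α : Form n p) : Form n (p + 1) :=
  fun x => ∑ i : Fin (p + 1), (-1 : ℝ) ^ (i : ℕ) * f (x i) * α (x ∘ i.succAbove)

/-- Interior product of a form by a vector. -/
def iotaV {n : ℕ} : {p : ℕ} → Evec n → Form n p → Form n (p - 1)
  | 0, _, _ => 0
  | _ + 1, v, α => fun x => α (Fin.cons v x)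


/-- Interior product (non-truncating version). -/
def iotaV' {n p : ℕ} (v : Evec n) (α : Form n (p + 1)) : Form n p :=
  fun x => α (Fin.cons v x)

/-- Interior product in the first block (non-truncating version). -/
def iotaL' {n p q : ℕ} (v : Evec n) (ω : DF n (p + 1) q) : DF n p q :=
  fun x y => ω (Fin.cons v x) y

/-- Interior product in the second block (non-truncating version). -/
def iotaR' {n p q : ℕ} (v : Evec n) (ω : DF n p (q + 1)) : DF n p q :=
  fun x y => ω x (Fin.cons v y)

/-- Embedding a homogeneous form into mixed forms. -/
def embF {n : ℕ} (p : ℕ) (α : Form n p) : MixedForm n :=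
  fun d => if h : d = p then cast (show Form n p = Form n d by rw [h]) α else 0

/-- Left Clifford multiplication `v · α` of a homogeneous form. -/
def cliffLone {n p : ℕ} (v : Evec n) (α : Form n p) : MixedForm n :=
  embF (p + 1) (wedgeC (fun u => ⟪v, u⟫) α) - embF (p - 1) (iotaV v α)

/-- Right Clifford multiplication `α · v` of a homogeneous form. -/
def cliffRone {n p : ℕ} (v : Evec n) (α : Form n p) : MixedForm n :=
  (-1 : ℝ) ^ p • (embF (p + 1) (wedgeC (fun u => ⟪v, u⟫) α) + embF (p - 1) (iotaV v α))

/-- Left Clifford multiplication by a vector on mixed forms. -/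
def cliffLv {n : ℕ} (v : Evec n) (ω : MixedForm n) : MixedForm n :=
  fun d => match d with
  | 0 => -(iotaV' v (ω 1))
  | d + 1 => wedgeC (fun u => ⟪v, u⟫) (ω d) - iotaV' v (ω (d + 1 + 1))

/-- Right Clifford multiplication by a vector on mixed forms. -/
def cliffRv {n : ℕ} (v : Evec n) (ω : MixedForm n) : MixedForm n :=
  fun d => match d with
  | 0 => -(iotaV' v (ω 1))
  | d + 1 => (-1 : ℝ) ^ d • (wedgeC (fun u => ⟪v, u⟫) (ω d) + iotaV' v (ω (d + 1 + 1)))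

/-- Left Clifford multiplication by a 2-form on mixed forms. -/
def cliffL2 {n : ℕ} (α : Evec n → Evec n → ℝ) (ω : MixedForm n) : MixedForm n :=
  (2:ℝ)⁻¹ • ∑ i, ∑ j, α (ebasis n i) (ebasis n j) • cliffLv (ebasis n i) (cliffLv (ebasis n j) ω)

/-- Right Clifford multiplication by a 2-form on mixed forms. -/
def cliffR2 {n : ℕ} (α : Evec n → Evec n → ℝ) (ω : MixedForm n) : MixedForm n :=
  (2:ℝ)⁻¹ • ∑ i, ∑ j, α (ebasis n i) (ebasis n j) • cliffRv (ebasis n j) (cliffRv (ebasis n i) ω)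

/-- Interior product by a vector in the first block of a double form. -/
def iotaL {n : ℕ} : {p q : ℕ} → Evec n → DF n p q → DF n (p - 1) q
  | 0, _, _, _ => 0
  | _ + 1, _, v, ω => fun x y => ω (Fin.cons v x) y

/-- Interior product by a vector in the second block of a double form. -/
def iotaR {n : ℕ} : {p q : ℕ} → Evec n → DF n p q → DF n p (q - 1)
  | _, 0, _, _ => 0
  | _, _ + 1, v, ω => fun x y => ω x (Fin.cons v y)

/-- Exterior multiplication by a covector in the first block. -/
def wedgeCL {n p q : ℕ} (f : Evec n → ℝ) (ω : DF n p q) : DF n (p + 1) q :=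
  fun x y => ∑ i : Fin (p + 1), (-1 : ℝ) ^ (i : ℕ) * f (x i) * ω (x ∘ i.succAbove) y

/-- Exterior multiplication by a covector in the second block. -/
def wedgeCR {n p q : ℕ} (f : Evec n → ℝ) (ω : DF n p q) : DF n p (q + 1) :=
  fun x y => ∑ j : Fin (q + 1), (-1 : ℝ) ^ (j : ℕ) * f (y j) * ω x (y ∘ j.succAbove)

/-- Left Clifford multiplication by a vector on the first factor of mixed double forms. -/
def cliffLvL {n : ℕ} (v : Evec n) (Ω : MixedDF n) : MixedDF n :=
  fun p q => match p with
  | 0 => -(iotaL' v (Ω 1 q))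
  | p + 1 => wedgeCL (fun u => ⟪v, u⟫) (Ω p q) - iotaL' v (Ω (p + 1 + 1) q)

/-- Right Clifford multiplication by a vector on the first factor of mixed double forms. -/
def cliffRvL {n : ℕ} (v : Evec n) (Ω : MixedDF n) : MixedDF n :=
  fun p q => match p with
  | 0 => -(iotaL' v (Ω 1 q))
  | p + 1 => (-1 : ℝ) ^ p • (wedgeCL (fun u => ⟪v, u⟫) (Ω p q) + iotaL' v (Ω (p + 1 + 1) q))

/-- Left Clifford multiplication by a vector on the second factor of mixed double forms. -/
def cliffLvR {n : ℕ} (v : Evec n) (Ω : MixedDF n) : MixedDF n :=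
  fun p q => match q with
  | 0 => -(iotaR' v (Ω p 1))
  | q + 1 => wedgeCR (fun u => ⟪v, u⟫) (Ω p q) - iotaR' v (Ω p (q + 1 + 1))

/-- Right Clifford multiplication by a vector on the second factor of mixed double forms. -/
def cliffRvR {n : ℕ} (v : Evec n) (Ω : MixedDF n) : MixedDF n :=
  fun p q => match q with
  | 0 => -(iotaR' v (Ω p 1))
  | q + 1 => (-1 : ℝ) ^ q • (wedgeCR (fun u => ⟪v, u⟫) (Ω p q) + iotaR' v (Ω p (q + 1 + 1)))

/-- Clifford commutator with a covector (1-form) on the first factor. -/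
def adLone {n : ℕ} (v : Evec n) (Ω : MixedDF n) : MixedDF n :=
  cliffLvL v Ω - cliffRvL v Ω

/-- Clifford commutator with a covector (1-form) on the second factor. -/
def adRone {n : ℕ} (v : Evec n) (Ω : MixedDF n) : MixedDF n :=
  cliffLvR v Ω - cliffRvR v Ω

/-- The sharp product of a `(1,1)` double form with a mixed double form. -/
def sharp11 {n : ℕ} (h : Evec n → Evec n → ℝ) (Ω : MixedDF n) : MixedDF n :=
  ∑ i, ∑ j, h (ebasis n i) (ebasis n j) • adLone (ebasis n i) (adRone (ebasis n j) Ω)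

/-- Clifford commutator with the 2-form `v ∧ w` (for orthonormal `v, w`) on the first factor. -/
def adLpair {n : ℕ} (v w : Evec n) (Ω : MixedDF n) : MixedDF n :=
  cliffLvL v (cliffLvL w Ω) - cliffRvL w (cliffRvL v Ω)

/-- Clifford commutator with the 2-form `v ∧ w` (for orthonormal `v, w`) on the second factor. -/
def adRpair {n : ℕ} (v w : Evec n) (Ω : MixedDF n) : MixedDF n :=
  cliffLvR v (cliffLvR w Ω) - cliffRvR w (cliffRvR v Ω)

/-- Clifford commutator with a 2-form on the first factor. -/
def adL2 {n : ℕ} (α : Evec n → Evec n → ℝ) (Ω : MixedDF n) : MixedDF n :=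
  (2:ℝ)⁻¹ • ∑ i, ∑ j, α (ebasis n i) (ebasis n j) • adLpair (ebasis n i) (ebasis n j) Ω

/-- Clifford commutator with a 2-form on the second factor. -/
def adR2 {n : ℕ} (α : Evec n → Evec n → ℝ) (Ω : MixedDF n) : MixedDF n :=
  (2:ℝ)⁻¹ • ∑ i, ∑ j, α (ebasis n i) (ebasis n j) • adRpair (ebasis n i) (ebasis n j) Ω

/-- The sharp product of a `(2,2)` double form with a mixed double form. -/
def sharpR {n : ℕ} (R : DF n 2 2) (Ω : MixedDF n) : MixedDF n :=
  (4:ℝ)⁻¹ • ∑ i, ∑ j, ∑ k, ∑ l,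
    R ![ebasis n i, ebasis n j] ![ebasis n k, ebasis n l] •
      adLpair (ebasis n i) (ebasis n j) (adRpair (ebasis n k) (ebasis n l) Ω)

/-- Embedding of a homogeneous double form into mixed double forms. -/
def embDF {n : ℕ} (p q : ℕ) (ω : DF n p q) : MixedDF n :=
  fun p' q' =>
    if h : p' = p ∧ q' = q then cast (show DF n p q = DF n p' q' by rw [h.1, h.2]) ω else 0

/-- Interior product of a double form by a `(1,1)` double form. -/
def iotaH {n : ℕ} : {p q : ℕ} → (Evec n → Evec n → ℝ) → DF n p q → DF n (p - 1) (q - 1)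
  | 0, _, _, _ => 0
  | _ + 1, 0, _, _ => 0
  | _ + 1, _ + 1, h, ω => fun x y =>
      ∑ i, ∑ j, h (ebasis n i) (ebasis n j) *
        ω (Fin.cons (ebasis n i) x) (Fin.cons (ebasis n j) y)

/-- Contraction of a double form, defined in every bidegree. -/
def contrAny {n : ℕ} : {p q : ℕ} → DF n p q → DF n (p - 1) (q - 1)
  | 0, _, _ => 0
  | _ + 1, 0, _ => 0
  | _ + 1, _ + 1, ω => fun x y =>
      ∑ i, ω (Fin.cons (ebasis n i) x) (Fin.cons (ebasis n i) y)

/-- The first Bianchi sum `𝔖`. -/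
def bianchiT {n : ℕ} : {p q : ℕ} → DF n p q → DF n (p + 1) (q - 1)
  | _, 0, _ => 0
  | p, _ + 1, ω => fun x y =>
      ∑ i, ∑ a : Fin (p + 1), (-1 : ℝ) ^ (a : ℕ) * ⟪ebasis n i, x a⟫ *
        ω (x ∘ a.succAbove) (Fin.cons (ebasis n i) y)

/-- The adjoint first Bianchi sum `𝔖̃`. -/
def bianchiAdjT {n : ℕ} : {p q : ℕ} → DF n p q → DF n (p - 1) (q + 1)
  | 0, _, _ => 0
  | _ + 1, q, ω => fun x y =>
      ∑ i, ∑ b : Fin (q + 1), (-1 : ℝ) ^ (b : ℕ) * ⟪ebasis n i, y b⟫ *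
        ω (Fin.cons (ebasis n i) x) (y ∘ b.succAbove)

/-- `g^{q-1} ρ(α) / (q-1)!`, the derivation extension of a `(1,1)` double form, with the
convention that it vanishes for `q = 0` (i.e. `g⁻¹ = 0`). -/
def gPowRho {n : ℕ} : (q : ℕ) → (Evec n → Evec n → ℝ) → DF n q q
  | 0, _ => 0
  | q + 1, α => ((q.factorial : ℝ))⁻¹ • wedge (gpow n q) (rho α)

/-- A 2-form is expressible in terms of `m` covectors. -/
def ExprBy {n : ℕ} (E : Evec n → Evec n → ℝ) (m : ℕ) : Prop :=
  ∃ (w : Fin m → Evec n) (c : Fin m → Fin m → ℝ), ∀ x y,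
    E x y = ∑ a, ∑ b, c a b * (⟪w a, x⟫ * ⟪w b, y⟫ - ⟪w a, y⟫ * ⟪w b, x⟫)

/-- Bundle an alternating multilinear kernel as an alternating map. -/
def altMap {n m : ℕ} (f : Form n m) (h : IsAltML f) : Evec n [⋀^Fin m]→ₗ[ℝ] ℝ where
  toFun := f
  map_update_add' := by
    intro inst x i a b
    have := h.1 x i 1 a b
    rw [Subsingleton.elim inst (instDecidableEqFin m)]
    simpa using this
  map_update_smul' := by
    intro inst x i c a
    rw [Subsingleton.elim inst (instDecidableEqFin m)]
    have h0 := h.1 x i 1 0 0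
    have := h.1 x i c a 0
    simp only [smul_zero, add_zero, one_mul, smul_eq_mul] at *
    linarith
  map_eq_zero_of_eq' := fun v i j hv hij => h.2 v i j hij hv

lemma altMap_apply {n m : ℕ} (f : Form n m) (h : IsAltML f) (x : Fin m → Evec n) :
    altMap f h x = f x := rfl

lemma alt_swap {n d : ℕ} (f : Form n (d + 1 + 1)) (h : IsAltML f) (v w : Evec n)
    (x : Fin d → Evec n) :
    f (Fin.cons v (Fin.cons w x)) = - f (Fin.cons w (Fin.cons v x)) := by
  have := (altMap f h).map_swap (v := Fin.cons w (Fin.cons v x)) (i := 0) (j := 1) (by simp)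
  rw [altMap_apply, altMap_apply] at this
  rw [← this]
  congr 1
  funext k
  refine Fin.cases ?_ (fun k => ?_) k
  · simp only [Function.comp, Equiv.swap_apply_left, Fin.cons_zero]
    rw [show (1 : Fin (d+1+1)) = Fin.succ 0 from rfl, Fin.cons_succ, Fin.cons_zero]
  · refine Fin.cases ?_ (fun k => ?_) k
    · simp only [Function.comp]
      rw [show (Fin.succ 0 : Fin (d+1+1)) = 1 from rfl, Equiv.swap_apply_right, Fin.cons_zero]
      rw [show (1 : Fin (d+1+1)) = Fin.succ 0 from rfl, Fin.cons_succ, Fin.cons_zero]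
    · simp only [Function.comp]
      rw [Equiv.swap_apply_of_ne_of_ne]
      · simp
      · exact Fin.succ_ne_zero _
      · rw [show (1 : Fin (d+1+1)) = Fin.succ 0 from rfl]
        exact fun h => Fin.succ_ne_zero _ (Fin.succ_injective _ h)

lemma alt_cons {n d : ℕ} (f : Form n (d + 1)) (h : IsAltML f) (v : Evec n)
    (x : Fin (d + 1) → Evec n) (a : Fin (d + 1)) :
    (-1 : ℝ) ^ (a : ℕ) * f (Fin.cons v (x ∘ a.succAbove)) = f (Function.update x a v) := by
  have := (altMap f h).map_insertNth a v (x ∘ a.succAbove)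
  rw [altMap_apply, altMap_apply] at this
  rw [zsmul_eq_mul] at this
  push_cast at this
  have h2 : (a.insertNth v (x ∘ a.succAbove) : Fin (d+1) → Evec n) = Function.update x a v := by
    have := Fin.insertNth_removeNth a v x
    exact this
  rw [h2] at this
  exact this.symm

lemma ebasis_expand {n : ℕ} (u : Evec n) : ∑ i, ⟪ebasis n i, u⟫ • ebasis n i = u := by
  have := (EuclideanSpace.basisFun (Fin n) ℝ).sum_repr' u
  simpa [ebasis] using this

lemma ebasis_inner {n : ℕ} (i j : Fin n) :
    ⟪ebasis n i, ebasis n j⟫ = if i = j then (1 : ℝ) else 0 := by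
  have := orthonormal_iff_ite.1 (EuclideanSpace.basisFun (Fin n) ℝ).orthonormal i j
  simpa [ebasis] using this

lemma ebasis_parseval {n : ℕ} (u w : Evec n) :
    ∑ i, ⟪ebasis n i, u⟫ * ⟪ebasis n i, w⟫ = ⟪u, w⟫ := by
  conv_rhs => rw [← ebasis_expand u]
  rw [sum_inner]
  simp [inner_smul_left]

lemma alt_expand {n d : ℕ} (f : Form n d) (h : IsAltML f)
    (x : Fin d → Evec n) (a : Fin d) :
    ∑ i, ⟪ebasis n i, x a⟫ * f (Function.update x a (ebasis n i)) = f x := by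
  have h1 : f x = altMap f h (Function.update x a (∑ i, ⟪ebasis n i, x a⟫ • ebasis n i)) := by
    rw [ebasis_expand, Function.update_eq_self]; rfl
  rw [h1, AlternatingMap.map_update_sum]
  refine Finset.sum_congr rfl fun i _ => ?_
  rw [AlternatingMap.map_update_smul]; rfl

/-- `ε_v ι_w` on forms of a fixed degree. -/
def Eop {n : ℕ} : {d : ℕ} → Evec n → Evec n → Form n d → Form n d
  | 0, _, _, _ => 0
  | _ + 1, v, w, α => wedgeC (fun u => ⟪v, u⟫) (iotaV' w α)

lemma Eop_zero {n : ℕ} (v w : Evec n) (α : Form n 0) : Eop v w α = 0 := rfl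
lemma Eop_succ {n d : ℕ} (v w : Evec n) (α : Form n (d + 1)) (x : Fin (d + 1) → Evec n) :
    Eop v w α x = ∑ a : Fin (d + 1), (-1 : ℝ) ^ (a : ℕ) * ⟪v, x a⟫ *
      α (Fin.cons w (x ∘ a.succAbove)) := rfl

lemma Eop_smul {n d : ℕ} (v w : Evec n) (c : ℝ) (α : Form n d) :
    Eop v w (c • α) = c • Eop v w α := by
  cases d with
  | zero => simp [Eop_zero]
  | succ d =>
    funext x
    simp only [Eop_succ, Pi.smul_apply, smul_eq_mul, Finset.mul_sum]
    exact Finset.sum_congr rfl fun _ _ => by ring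

lemma Eop_sub {n d : ℕ} (v w : Evec n) (α β : Form n d) :
    Eop v w (α - β) = Eop v w α - Eop v w β := by
  cases d with
  | zero => simp [Eop_zero]
  | succ d =>
    funext x
    simp only [Eop_succ, Pi.sub_apply, ← Finset.sum_sub_distrib]
    exact Finset.sum_congr rfl fun _ _ => by ring

lemma Eop_neg {n d : ℕ} (v w : Evec n) (α : Form n d) :
    Eop v w (-α) = - Eop v w α := by
  have := Eop_smul v w (-1) α
  simpa using this

lemma Eop_trace {n d : ℕ} (α : Form n d) (h : IsAltML α) (x : Fin d → Evec n) :
    ∑ i, Eop (ebasis n i) (ebasis n i) α x = d * α x := by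
  cases d with
  | zero => simp [Eop_zero]
  | succ d =>
    simp only [Eop_succ]
    rw [Finset.sum_comm]
    have : ∀ a : Fin (d + 1), ∑ i, (-1 : ℝ) ^ (a : ℕ) * ⟪ebasis n i, x a⟫ *
        α (Fin.cons (ebasis n i) (x ∘ a.succAbove)) = α x := by
      intro a
      rw [← alt_expand α h x a]
      refine Finset.sum_congr rfl fun i _ => ?_
      rw [← alt_cons α h]; ring
    simp [this]

lemma wedgeC_add {n d : ℕ} (f : Evec n → ℝ) (α β : Form n d) :
    wedgeC f (α + β) = wedgeC f α + wedgeC f β := by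
  funext x
  simp only [wedgeC, Pi.add_apply, ← Finset.sum_add_distrib]
  exact Finset.sum_congr rfl fun _ _ => by ring

lemma wedgeC_smul {n d : ℕ} (f : Evec n → ℝ) (c : ℝ) (α : Form n d) :
    wedgeC f (c • α) = c • wedgeC f α := by
  funext x
  simp only [wedgeC, Pi.smul_apply, smul_eq_mul, Finset.mul_sum]
  exact Finset.sum_congr rfl fun _ _ => by ring

lemma wedgeC_neg {n d : ℕ} (f : Evec n → ℝ) (α : Form n d) :
    wedgeC f (-α) = - wedgeC f α := by
  have := wedgeC_smul f (-1) α
  simpa using this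

lemma wedgeC_sub {n d : ℕ} (f : Evec n → ℝ) (α β : Form n d) :
    wedgeC f (α - β) = wedgeC f α - wedgeC f β := by
  rw [sub_eq_add_neg, wedgeC_add, wedgeC_neg, ← sub_eq_add_neg]

lemma wedgeC_cons_zero {n : ℕ} (f : Evec n → ℝ) (α : Form n 0) (v : Evec n)
    (x : Fin 0 → Evec n) : wedgeC f α (Fin.cons v x) = f v * α x := by
  simp only [wedgeC, Fin.sum_univ_succ]
  simp

lemma cons_comp_succAbove {n d : ℕ} (v : Evec n) (x : Fin (d + 1) → Evec n) (a : Fin (d + 1)) :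
    (Fin.cons v x : Fin (d + 1 + 1) → Evec n) ∘ a.succ.succAbove
      = Fin.cons v (x ∘ a.succAbove) := by
  funext k
  refine Fin.cases ?_ (fun k => ?_) k
  · simp
  · simp

lemma wedgeC_cons {n d : ℕ} (f : Evec n → ℝ) (α : Form n (d + 1)) (v : Evec n)
    (x : Fin (d + 1) → Evec n) :
    wedgeC f α (Fin.cons v x) = f v * α x - wedgeC f (iotaV' v α) x := by
  simp only [wedgeC, iotaV']
  rw [Fin.sum_univ_succ, sub_eq_add_neg, ← Finset.sum_neg_distrib]
  congr 1
  · simp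
  · refine Finset.sum_congr rfl fun a _ => ?_
    rw [cons_comp_succAbove]
    simp only [Fin.val_succ, Fin.cons_succ, pow_succ]
    ring

lemma wedgeC_anti {n d : ℕ} (f h : Evec n → ℝ) (α : Form n d) :
    wedgeC f (wedgeC h α) = - wedgeC h (wedgeC f α) := by
  funext x
  simp only [wedgeC, Pi.neg_apply, Finset.mul_sum]
  rw [← Finset.sum_neg_distrib]
  simp only [← Finset.sum_neg_distrib]
  rw [← Fintype.sum_prod_type', ← Fintype.sum_prod_type']
  have hinv : Function.Involutive (fun z : Fin (d + 1 + 1) × Fin (d + 1) =>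
      ((z.1.succAbove z.2, z.2.predAbove z.1) : Fin (d + 1 + 1) × Fin (d + 1))) := by
    rintro ⟨i, j⟩
    ext1
    · simp [Fin.succAbove_succAbove_predAbove]
    · apply Fin.succAbove_right_injective (p := i)
      have h1 := Fin.succAbove_succAbove_predAbove (i.succAbove j) (j.predAbove i)
      rw [Fin.succAbove_succAbove_predAbove i j] at h1
      exact h1
  refine Fintype.sum_equiv hinv.toPerm _ _ ?_
  rintro ⟨i, j⟩
  simp only [Function.Involutive.coe_toPerm, Function.comp, Fin.succAbove_succAbove_predAbove]
  have hx : (x ∘ (i.succAbove j).succAbove) ∘ (j.predAbove i).succAbove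
      = (x ∘ i.succAbove) ∘ j.succAbove := by
    funext k
    simp only [Function.comp]
    rw [Fin.succAbove_succAbove_succAbove_predAbove]
  have hs := Fin.neg_one_pow_succAbove_add_predAbove (R := ℝ) i j
  simp only [pow_add] at hs
  have e1 : ∀ (A B C D E : ℝ), -(A * B * (C * D * E)) = -(A * C) * (B * D * E) := by intros; ring
  have e2 : ∀ (A B C D E : ℝ), A * B * (C * D * E) = (A * C) * (B * D * E) := by intros; ring
  rw [e1, e2, hs, hx]
  ring

/-- Single-block commutator. -/
def adOne {n : ℕ} (v w : Evec n) (Ω : MixedForm n) : MixedForm n :=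
  cliffLv v (cliffLv w Ω) - cliffRv w (cliffRv v Ω)

lemma adOne_eq {n : ℕ} (v w : Evec n) (hvw : ⟪v, w⟫ = (0 : ℝ)) (Ω : MixedForm n)
    (hs : ∀ d (x : Fin d → Evec n), Ω (d + 1 + 1) (Fin.cons v (Fin.cons w x))
      = - Ω (d + 1 + 1) (Fin.cons w (Fin.cons v x))) (d : ℕ) (x : Fin d → Evec n) :
    adOne v w Ω d x = (-2 : ℝ) * (Eop v w (Ω d) x - Eop w v (Ω d) x) := by
  have hwv : ⟪w, v⟫ = (0 : ℝ) := by rw [real_inner_comm]; exact hvw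
  rcases d with _ | _ | d
  · simp only [adOne, cliffLv, cliffRv, Pi.sub_apply, Pi.neg_apply, iotaV', Pi.smul_apply,
      Pi.add_apply, Eop_zero, Pi.zero_apply, zero_add, pow_zero, one_smul, wedgeC_cons_zero,
      hvw, hwv]
    have := hs 0 x
    linarith
  · simp only [adOne, cliffLv, cliffRv, Pi.sub_apply, Pi.smul_apply, Pi.add_apply, wedgeC_neg,
      Pi.neg_apply]
    have e1 : ∀ u u' : Evec n, iotaV' u (wedgeC (fun t => ⟪u', t⟫) (Ω (0 + 1))) x
      = ⟪u', u⟫ * Ω (0 + 1) x - wedgeC (fun t => ⟪u', t⟫) (iotaV' u (Ω (0 + 1))) x :=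
      fun u u' => wedgeC_cons _ _ _ _
    have e2 : iotaV' v (iotaV' w (Ω (0 + 1 + 1 + 1))) x
      = - iotaV' w (iotaV' v (Ω (0 + 1 + 1 + 1))) x := by
      have := hs (0 + 1) x
      simp only [iotaV']; rw [this]; ring
    have e3 : ∀ (a b : Form n (0 + 1 + 1)) (u : Evec n), iotaV' u (a - b) x
      = iotaV' u a x - iotaV' u b x := fun _ _ _ => rfl
    have e4 : ∀ (c : ℝ) (a b : Form n (0 + 1 + 1)) (u : Evec n), iotaV' u (c • (a + b)) x
      = c * (iotaV' u a x + iotaV' u b x) := fun _ _ _ _ => rfl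
    simp only [e3, e4, e1, e2, hvw, hwv]
    simp only [Eop, smul_eq_mul]
    norm_num
    ring
  · simp only [adOne, cliffLv, cliffRv, Pi.sub_apply, Pi.smul_apply, Pi.add_apply, wedgeC_sub,
      wedgeC_smul, wedgeC_add]
    have e1 : ∀ u u' : Evec n, iotaV' u (wedgeC (fun t => ⟪u', t⟫) (Ω (d + 1 + 1))) x
      = ⟪u', u⟫ * Ω (d + 1 + 1) x - wedgeC (fun t => ⟪u', t⟫) (iotaV' u (Ω (d + 1 + 1))) x :=
      fun u u' => wedgeC_cons _ _ _ _
    have e2 : iotaV' v (iotaV' w (Ω (d + 1 + 1 + 1 + 1))) x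
      = - iotaV' w (iotaV' v (Ω (d + 1 + 1 + 1 + 1))) x := by
      have := hs (d + 1 + 1) x
      simp only [iotaV']; rw [this]; ring
    have e3 : ∀ (a b : Form n (d + 1 + 1 + 1)) (u : Evec n), iotaV' u (a - b) x
      = iotaV' u a x - iotaV' u b x := fun _ _ _ => rfl
    have e4 : ∀ (c : ℝ) (a b : Form n (d + 1 + 1 + 1)) (u : Evec n), iotaV' u (c • (a + b)) x
      = c * (iotaV' u a x + iotaV' u b x) := fun _ _ _ _ => rfl
    have e5 : wedgeC (fun u => ⟪v, u⟫) (wedgeC (fun u => ⟪w, u⟫) (Ω d)) x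
      = - wedgeC (fun u => ⟪w, u⟫) (wedgeC (fun u => ⟪v, u⟫) (Ω d)) x := by
      rw [wedgeC_anti]; rfl
    have hsq : ((-1 : ℝ) ^ d) * (-1) ^ d = 1 := by
      rw [← mul_pow]; simp
    simp only [e3, e4, e1, e2, e5, hvw, hwv, Eop, smul_eq_mul, pow_succ]
    linear_combination (wedgeC (fun u => ⟪w, u⟫) (wedgeC (fun u => ⟪v, u⟫) (Ω d)) x
      + wedgeC (fun u => ⟪w, u⟫) (iotaV' v (Ω (d + 1 + 1))) x
      - wedgeC (fun u => ⟪v, u⟫) (iotaV' w (Ω (d + 1 + 1))) x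
      + iotaV' w (iotaV' v (Ω (d + 1 + 1 + 1 + 1))) x) * hsq

lemma perm_sum_aux {n m : ℕ} (G : Evec n → Form n m)
    (hG : ∀ u x (σ : Equiv.Perm (Fin m)),
      G u (x ∘ σ) = ((Equiv.Perm.sign σ : ℤ) : ℝ) * G u x) (x : Fin (m + 1) → Evec n) :
    ∑ σ : Equiv.Perm (Fin (m + 1)), ((Equiv.Perm.sign σ : ℤ) : ℝ) *
        G (x (σ 0)) (fun i => x (σ i.succ))
      = (m.factorial : ℝ) *
        ∑ a : Fin (m + 1), (-1 : ℝ) ^ (a : ℕ) * G (x a) (x ∘ a.succAbove) := by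
  let φ : Fin (m + 1) × Equiv.Perm (Fin m) → Equiv.Perm (Fin (m + 1)) :=
    fun z => z.1.cycleRange.symm * Equiv.Perm.decomposeFin.symm (0, z.2)
  have h0 : ∀ z, φ z 0 = z.1 := by
    rintro ⟨a, e⟩; simp [φ]
  have h1 : ∀ z k, φ z (Fin.succ k) = z.1.succAbove (z.2 k) := by
    rintro ⟨a, e⟩ k; simp [φ]
  have hsgn : ∀ z, ((Equiv.Perm.sign (φ z) : ℤ) : ℝ)
      = (-1 : ℝ) ^ (z.1 : ℕ) * ((Equiv.Perm.sign z.2 : ℤ) : ℝ) := by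
    rintro ⟨a, e⟩
    simp only [φ, Equiv.Perm.sign_mul, Equiv.Perm.decomposeFin.symm_sign, Equiv.Perm.sign_symm,
      Fin.sign_cycleRange]
    simp
  have hbij : Function.Bijective φ := by
    rw [Fintype.bijective_iff_injective_and_card]
    refine ⟨?_, ?_⟩
    · rintro ⟨a, e⟩ ⟨b, f⟩ hab
      have hh : a = b := by
        have := h0 (a, e)
        rw [hab, h0] at this
        exact this.symm
      subst hh
      congr 1
      ext k
      have := h1 (a, e) k
      rw [hab, h1] at this
      exact congrArg Fin.val (Fin.succAbove_right_injective this).symm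
    · simp [Fintype.card_perm, Nat.factorial_succ]
  rw [← Fintype.sum_bijective φ hbij (fun z => ((Equiv.Perm.sign (φ z) : ℤ) : ℝ) *
        G (x (φ z 0)) (fun i => x (φ z i.succ))) _ (fun _ => rfl)]
  rw [Fintype.sum_prod_type, Finset.mul_sum]
  refine Finset.sum_congr rfl fun a _ => ?_
  have : ∀ e : Equiv.Perm (Fin m), ((Equiv.Perm.sign (φ (a, e)) : ℤ) : ℝ) *
        G (x (φ (a, e) 0)) (fun i => x (φ (a, e) i.succ))
      = (-1 : ℝ) ^ (a : ℕ) * G (x a) (x ∘ a.succAbove) := by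
    intro e
    rw [hsgn, h0]
    have e1 : (fun i => x (φ (a, e) (Fin.succ i))) = (x ∘ a.succAbove) ∘ e := by
      funext i; rw [h1]; rfl
    rw [e1, hG]
    have hsq : ((Equiv.Perm.sign e : ℤ) : ℝ) * ((Equiv.Perm.sign e : ℤ) : ℝ) = 1 := by
      rcases Int.units_eq_one_or (Equiv.Perm.sign e) with h | h <;> simp [h]
    linear_combination ((-1 : ℝ) ^ (a : ℕ) * G (x a) (x ∘ a.succAbove)) * hsq
  simp only [this]
  simp [Fintype.card_perm]

lemma perm_sum {n m : ℕ} (G : Evec n → Form n m)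
    (hG : ∀ u x (σ : Equiv.Perm (Fin m)),
      G u (x ∘ σ) = ((Equiv.Perm.sign σ : ℤ) : ℝ) * G u x) (x : Fin (m + 1) → Evec n)
    (h : 1 + m = m + 1) :
    ∑ σ : Equiv.Perm (Fin (1 + m)), ((Equiv.Perm.sign σ : ℤ) : ℝ) *
        G ((x ∘ Fin.cast h) (σ (Fin.castAdd m 0)))
          (fun i => (x ∘ Fin.cast h) (σ (Fin.natAdd 1 i)))
      = (m.factorial : ℝ) *
        ∑ a : Fin (m + 1), (-1 : ℝ) ^ (a : ℕ) * G (x a) (x ∘ a.succAbove) := by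
  rw [← perm_sum_aux G hG x]
  refine Fintype.sum_equiv (finCongr h).permCongr _ _ fun σ => ?_
  rw [Equiv.Perm.sign_permCongr]
  congr 2
  simp only [Function.comp, Equiv.permCongr_apply, finCongr_apply]
  funext i
  congr 3
  ext
  simp [Nat.add_comm]

lemma wedge_gdf {n p q : ℕ} (η : DF n p q)
    (hx : ∀ x y (σ : Equiv.Perm (Fin p)),
      η (x ∘ σ) y = ((Equiv.Perm.sign σ : ℤ) : ℝ) * η x y)
    (hy : ∀ x y (σ : Equiv.Perm (Fin q)),
      η x (y ∘ σ) = ((Equiv.Perm.sign σ : ℤ) : ℝ) * η x y)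
    (x : Fin (p + 1) → Evec n) (y : Fin (q + 1) → Evec n)
    (h : 1 + p = p + 1) (h' : 1 + q = q + 1) :
    wedge (gdf n) η (x ∘ Fin.cast h) (y ∘ Fin.cast h')
      = ∑ a : Fin (p + 1), ∑ b : Fin (q + 1), (-1 : ℝ) ^ (a : ℕ) * (-1 : ℝ) ^ (b : ℕ) *
          ⟪x a, y b⟫ * η (x ∘ a.succAbove) (y ∘ b.succAbove) := by
  have key := perm_sum (fun u x' => ∑ τ : Equiv.Perm (Fin (1 + q)),
      ((Equiv.Perm.sign τ : ℤ) : ℝ) * (⟪u, (y ∘ Fin.cast h') (τ (Fin.castAdd q 0))⟫ *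
        η x' (fun j => (y ∘ Fin.cast h') (τ (Fin.natAdd 1 j))))) (by
      intro u x' σ
      simp only [hx, Finset.mul_sum]
      exact Finset.sum_congr rfl fun _ _ => by ring) x h
  have key2 : ∀ u x', ∑ τ : Equiv.Perm (Fin (1 + q)),
      ((Equiv.Perm.sign τ : ℤ) : ℝ) * (⟪u, (y ∘ Fin.cast h') (τ (Fin.castAdd q 0))⟫ *
        η x' (fun j => (y ∘ Fin.cast h') (τ (Fin.natAdd 1 j))))
      = (q.factorial : ℝ) * ∑ b : Fin (q + 1), (-1 : ℝ) ^ (b : ℕ) * (⟪u, y b⟫ *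
          η x' (y ∘ b.succAbove)) := fun u x' =>
    perm_sum (fun w y' => ⟪u, w⟫ * η x' y') (by intro w y' σ; simp only [hy]; ring) y h'
  simp only [key2] at key
  unfold wedge
  have e : ∀ σ : Equiv.Perm (Fin (1 + p)), ∑ τ : Equiv.Perm (Fin (1 + q)),
      ((Equiv.Perm.sign σ : ℤ) : ℝ) * ((Equiv.Perm.sign τ : ℤ) : ℝ) *
        gdf n (fun i => (x ∘ Fin.cast h) (σ (Fin.castAdd p i)))
          (fun j => (y ∘ Fin.cast h') (τ (Fin.castAdd q j))) *
        η (fun i => (x ∘ Fin.cast h) (σ (Fin.natAdd 1 i)))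
          (fun j => (y ∘ Fin.cast h') (τ (Fin.natAdd 1 j)))
      = ((Equiv.Perm.sign σ : ℤ) : ℝ) * ((q.factorial : ℝ) * ∑ b : Fin (q + 1),
        (-1 : ℝ) ^ (b : ℕ) * (⟪(x ∘ Fin.cast h) (σ (Fin.castAdd p 0)), y b⟫ *
          η (fun i => (x ∘ Fin.cast h) (σ (Fin.natAdd 1 i))) (y ∘ b.succAbove))) := by
    intro σ
    rw [← key2, Finset.mul_sum]
    refine Finset.sum_congr rfl fun τ _ => ?_
    simp only [gdf]
    ring
  simp only [e]
  rw [key]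
  have hp : (p.factorial : ℝ) ≠ 0 := by positivity
  have hq : (q.factorial : ℝ) ≠ 0 := by positivity
  simp only [Finset.mul_sum, Nat.factorial_one, one_mul, mul_one]
  push_cast
  refine Finset.sum_congr rfl fun a _ => Finset.sum_congr rfl fun b _ => ?_
  field_simp

lemma alt_perm_cons {n d : ℕ} (f : Form n (d + 1)) (h : IsAltML f) (v : Evec n)
    (x : Fin d → Evec n) (σ : Equiv.Perm (Fin d)) :
    f (Fin.cons v (x ∘ σ)) = ((Equiv.Perm.sign σ : ℤ) : ℝ) * f (Fin.cons v x) := by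
  have := ((altMap f h).curryLeft v).map_perm x σ
  rw [Units.smul_def, zsmul_eq_mul] at this
  exact this

lemma embDF_apply {n p q p' q' : ℕ} (ω : DF n p q) (hp : p' = p) (hq : q' = q)
    (x : Fin p' → Evec n) (y : Fin q' → Evec n) :
    embDF p q ω p' q' x y = ω (x ∘ Fin.cast hp.symm) (y ∘ Fin.cast hq.symm) := by
  subst hp hq
  simp [embDF]

lemma embDF_self {n p q : ℕ} (ω : DF n p q) : embDF p q ω p q = ω := by
  simp [embDF]

lemma embDF_ne {n p q p' q' : ℕ} (ω : DF n p q) (h : ¬ (p' = p ∧ q' = q)) :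
    embDF p q ω p' q' = 0 := by
  simp [embDF, h]

lemma embDF_zero {n p q : ℕ} : embDF p q (0 : DF n p q) = 0 := by
  funext p' q'
  by_cases h : p' = p ∧ q' = q
  · obtain ⟨rfl, rfl⟩ := h
    simp [embDF]
  · rw [embDF_ne _ h]; rfl

lemma gpow_two {n : ℕ} (a b c d : Evec n) :
    gpow n 2 ![a, b] ![c, d] = 2 * (⟪a, c⟫ * ⟪b, d⟫ - ⟪a, d⟫ * ⟪b, c⟫) := by
  have h1 : ∀ x y, gpow n 1 x y = ⟪x 0, y 0⟫ := by
    intro x y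
    simp only [gpow, wedge, gdf]
    simp
  have h2 : (Finset.univ : Finset (Equiv.Perm (Fin (1 + 1)))) = {1, Equiv.swap 0 1} := by decide
  have h3 : (1 : Equiv.Perm (Fin (1 + 1))) ≠ Equiv.swap 0 1 := by decide
  show wedge (gpow n 1) (gdf n) _ _ = _
  simp only [wedge, h1, gdf, h2, Finset.sum_pair h3]
  have e1 : (Fin.castAdd 1 (0 : Fin 1)) = (0 : Fin (1 + 1)) := rfl
  have e2 : (Fin.natAdd 1 (0 : Fin 1)) = (1 : Fin (1 + 1)) := rfl
  simp only [e1, e2, Equiv.Perm.sign_one, Equiv.Perm.sign_swap (show (0 : Fin (1+1)) ≠ 1 by decide),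
    Equiv.Perm.one_apply, Equiv.swap_apply_left, Equiv.swap_apply_right]
  simp
  ring

/-- The elementary contribution `(ε_v ι_w) ⊗ (ε_v' ι_w')`. -/
def Tfun {n p q : ℕ} (ω : DF n p q) (x : Fin p → Evec n) (y : Fin q → Evec n)
    (i j k l : Fin n) : ℝ :=
  Eop (ebasis n i) (ebasis n j) (fun x' => Eop (ebasis n k) (ebasis n l) (ω x') y) x

lemma adRpair_apply {n : ℕ} (v w : Evec n) (Ω : MixedDF n) (p q : ℕ)
    (x : Fin p → Evec n) (y : Fin q → Evec n) :
    adRpair v w Ω p q x y = adOne v w (fun q' y' => Ω p q' x y') q y := by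
  have h1 : ∀ (u : Evec n) (Ω : MixedDF n), (fun q' y' => cliffLvR u Ω p q' x y')
      = cliffLv u (fun q' y' => Ω p q' x y') := by
    intro u Ω; funext q' y'; cases q' <;> rfl
  have h2 : ∀ (u : Evec n) (Ω : MixedDF n), (fun q' y' => cliffRvR u Ω p q' x y')
      = cliffRv u (fun q' y' => Ω p q' x y') := by
    intro u Ω; funext q' y'; cases q' <;> rfl
  simp only [adOne, ← h1, ← h2]
  rfl

lemma adLpair_apply {n : ℕ} (v w : Evec n) (Ω : MixedDF n) (p q : ℕ)
    (x : Fin p → Evec n) (y : Fin q → Evec n) :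
    adLpair v w Ω p q x y = adOne v w (fun p' x' => Ω p' q x' y) p x := by
  have h1 : ∀ (u : Evec n) (Ω : MixedDF n), (fun p' x' => cliffLvL u Ω p' q x' y)
      = cliffLv u (fun p' x' => Ω p' q x' y) := by
    intro u Ω; funext p' x'; cases p' <;> rfl
  have h2 : ∀ (u : Evec n) (Ω : MixedDF n), (fun p' x' => cliffRvL u Ω p' q x' y)
      = cliffRv u (fun p' x' => Ω p' q x' y) := by
    intro u Ω; funext p' x'; cases p' <;> rfl
  simp only [adOne, ← h1, ← h2]
  rfl

lemma ad_ad {n : ℕ} (Ω : MixedDF n) (hΩ : ∀ p q, IsDF (Ω p q)) (p q : ℕ)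
    (x : Fin p → Evec n) (y : Fin q → Evec n) (i j k l : Fin n) (hij : i ≠ j) (hkl : k ≠ l) :
    adLpair (ebasis n i) (ebasis n j) (adRpair (ebasis n k) (ebasis n l) Ω) p q x y
      = 4 * (Tfun (Ω p q) x y i j k l - Tfun (Ω p q) x y j i k l
        - Tfun (Ω p q) x y i j l k + Tfun (Ω p q) x y j i l k) := by
  have hR : ∀ p' (x' : Fin p' → Evec n),
      adRpair (ebasis n k) (ebasis n l) Ω p' q x' y = (-2 : ℝ) *
        (Eop (ebasis n k) (ebasis n l) (Ω p' q x') y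
          - Eop (ebasis n l) (ebasis n k) (Ω p' q x') y) := by
    intro p' x'
    rw [adRpair_apply, adOne_eq]
    · rw [ebasis_inner, if_neg hkl]
    · intro d z
      exact alt_swap _ ((hΩ p' _).2 x') _ _ _
  rw [adLpair_apply, adOne_eq]
  · have e : (fun x' => adRpair (ebasis n k) (ebasis n l) Ω p q x' y) = (-2 : ℝ) •
        ((fun x' => Eop (ebasis n k) (ebasis n l) (Ω p q x') y)
          - (fun x' => Eop (ebasis n l) (ebasis n k) (Ω p q x') y)) := by
      funext x'; rw [hR]; rfl
    rw [e, Eop_smul, Eop_smul, Eop_sub, Eop_sub]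
    simp only [Pi.smul_apply, Pi.sub_apply, smul_eq_mul, Tfun]
    ring
  · rw [ebasis_inner, if_neg hij]
  · intro d z
    rw [hR, hR]
    have : Ω (d + 1 + 1) q (Fin.cons (ebasis n i) (Fin.cons (ebasis n j) z))
        = - Ω (d + 1 + 1) q (Fin.cons (ebasis n j) (Fin.cons (ebasis n i) z)) := by
      funext y'
      exact alt_swap _ ((hΩ (d + 1 + 1) q).1 y') _ _ _
    rw [this, Eop_neg, Eop_neg]
    simp only [Pi.neg_apply]
    ring

lemma delta_sum {n : ℕ} (T : Fin n → Fin n → Fin n → Fin n → ℝ) :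
    ∑ i, ∑ j, ∑ k, ∑ l, (2 * ((if i = k then (1 : ℝ) else 0) * (if j = l then 1 else 0)
        - (if i = l then 1 else 0) * (if j = k then 1 else 0))) *
        (4 * (T i j k l - T j i k l - T i j l k + T j i l k))
      = 32 * (∑ i, ∑ j, T i j i j - ∑ i, ∑ j, T i j j i) := by
  have h1 : ∀ i j, ∑ k, ∑ l, (2 * ((if i = k then (1 : ℝ) else 0) * (if j = l then 1 else 0)
        - (if i = l then 1 else 0) * (if j = k then 1 else 0))) *
        (4 * (T i j k l - T j i k l - T i j l k + T j i l k))
      = 16 * (T i j i j - T j i i j - T i j j i + T j i j i) := by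
    intro i j
    simp only [mul_sub, sub_mul, Finset.sum_sub_distrib, mul_ite, ite_mul, mul_one, mul_zero,
      zero_mul, Finset.sum_ite_eq, Finset.mem_univ, if_true]
    have : ∀ F : Fin n → Fin n → ℝ, ∑ k, ∑ l, (if j = k then (if i = l then F k l else 0) else 0)
        = F j i := by
      intro F; simp
    simp [Finset.sum_ite_eq]
    ring
  simp only [h1]
  simp only [← Finset.mul_sum, Finset.sum_add_distrib, Finset.sum_sub_distrib]
  rw [Finset.sum_comm (f := fun i j => T j i i j), Finset.sum_comm (f := fun i j => T j i j i)]
  ring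

lemma sharp_value {n : ℕ} (Ω : MixedDF n) (hΩ : ∀ p q, IsDF (Ω p q)) (p q : ℕ)
    (x : Fin p → Evec n) (y : Fin q → Evec n) :
    ((2 : ℝ)⁻¹ • sharpR (gpow n 2) Ω) p q x y
      = 4 * (∑ i, ∑ j, Tfun (Ω p q) x y i j i j - ∑ i, ∑ j, Tfun (Ω p q) x y i j j i) := by
  have key := delta_sum (Tfun (Ω p q) x y)
  simp only [sharpR, Pi.smul_apply, Finset.sum_apply, smul_eq_mul]
  have e : ∀ i j k l : Fin n, gpow n 2 ![ebasis n i, ebasis n j] ![ebasis n k, ebasis n l] *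
      adLpair (ebasis n i) (ebasis n j) (adRpair (ebasis n k) (ebasis n l) Ω) p q x y
      = (2 * ((if i = k then (1 : ℝ) else 0) * (if j = l then 1 else 0)
        - (if i = l then 1 else 0) * (if j = k then 1 else 0))) *
        (4 * (Tfun (Ω p q) x y i j k l - Tfun (Ω p q) x y j i k l
        - Tfun (Ω p q) x y i j l k + Tfun (Ω p q) x y j i l k)) := by
    intro i j k l
    rw [gpow_two]
    simp only [ebasis_inner]
    by_cases hij : i = j
    · subst hij; ring
    by_cases hkl : k = l
    · subst hkl; ring
    rw [ad_ad Ω hΩ p q x y i j k l hij hkl]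
  simp only [e]
  rw [key]
  ring

lemma isDF_zero {n p q : ℕ} : IsDF (0 : DF n p q) := by
  constructor <;> intro z <;> constructor <;> intros <;> simp

lemma isDF_emb {n p q : ℕ} (ω : DF n p q) (h : IsDF ω) (p' q' : ℕ) :
    IsDF (embDF p q ω p' q') := by
  by_cases hh : p' = p ∧ q' = q
  · obtain ⟨rfl, rfl⟩ := hh
    rw [embDF_self]; exact h
  · rw [embDF_ne _ hh]; exact isDF_zero

lemma Eop_zero_form {n d : ℕ} (v w : Evec n) : Eop v w (0 : Form n d) = 0 := by
  simpa using Eop_smul v w 0 (0 : Form n d)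

lemma Tfun_zero {n p q : ℕ} (x : Fin p → Evec n) (y : Fin q → Evec n) (i j k l : Fin n) :
    Tfun (0 : DF n p q) x y i j k l = 0 := by
  have : (fun x' => Eop (ebasis n k) (ebasis n l) ((0 : DF n p q) x') y) = 0 := by
    funext x'
    exact congrFun (Eop_zero_form _ _) y
  rw [Tfun, this, Eop_zero_form]; rfl

lemma Tfun_q0 {n p : ℕ} (ω : DF n p 0) (x : Fin p → Evec n) (y : Fin 0 → Evec n)
    (i j k l : Fin n) : Tfun ω x y i j k l = 0 := by
  have : (fun x' => Eop (ebasis n k) (ebasis n l) (ω x') y) = 0 := rfl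
  rw [Tfun, this, Eop_zero_form]; rfl

lemma Tfun_succ {n p q : ℕ} (ω : DF n (p + 1) (q + 1)) (x : Fin (p + 1) → Evec n)
    (y : Fin (q + 1) → Evec n) (i j k l : Fin n) :
    Tfun ω x y i j k l = ∑ a : Fin (p + 1), ∑ b : Fin (q + 1),
      (-1 : ℝ) ^ (a : ℕ) * (-1 : ℝ) ^ (b : ℕ) * (⟪ebasis n i, x a⟫ * ⟪ebasis n k, y b⟫) *
        ω (Fin.cons (ebasis n j) (x ∘ a.succAbove)) (Fin.cons (ebasis n l) (y ∘ b.succAbove)) := by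
  simp only [Tfun, Eop_succ, Finset.mul_sum]
  exact Finset.sum_congr rfl fun a _ => Finset.sum_congr rfl fun b _ => by ring

lemma sum4_comm {α β : Type} [Fintype α] [Fintype β] {m k : ℕ}
    (F : α → β → Fin m → Fin k → ℝ) :
    ∑ i, ∑ j, ∑ a, ∑ b, F i j a b = ∑ a, ∑ b, ∑ i, ∑ j, F i j a b := by
  have h1 : ∀ i, ∑ j, ∑ a, ∑ b, F i j a b = ∑ a, ∑ b, ∑ j, F i j a b := by
    intro i
    rw [Finset.sum_comm]
    exact Finset.sum_congr rfl fun a _ => Finset.sum_comm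
  simp only [h1]
  rw [Finset.sum_comm]
  exact Finset.sum_congr rfl fun a _ => Finset.sum_comm

lemma gc_value {n p q : ℕ} (ω : DF n p q) (hω : IsDF ω) (x : Fin p → Evec n)
    (y : Fin q → Evec n) :
    embDF (1 + (p - 1)) (1 + (q - 1)) (wedge (gdf n) (contrAny ω)) p q x y
      = ∑ i, ∑ j, Tfun ω x y i j i j := by
  have wz : ∀ {p q : ℕ}, wedge (gdf n) (0 : DF n p q) = 0 := by
    intro p q; funext x y; simp [wedge]
  rcases p with _ | p
  · have : contrAny ω = 0 := by cases q <;> rfl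
    rw [this, wz, embDF_zero]
    simp [Tfun, Eop_zero]
  rcases q with _ | q
  · have : contrAny ω = 0 := rfl
    rw [this, wz, embDF_zero]
    simp [Tfun_q0]
  rw [embDF_apply _ (show p + 1 = 1 + (p + 1 - 1) by omega) (show q + 1 = 1 + (q + 1 - 1) by omega)]
  have hw := wedge_gdf (n := n) (p := p) (q := q) (contrAny ω) (by
      intro x y σ
      simp only [contrAny, Finset.mul_sum]
      exact Finset.sum_congr rfl fun i _ => alt_perm_cons _ (hω.1 _) _ _ _) (by
      intro x y σ
      simp only [contrAny, Finset.mul_sum]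
      exact Finset.sum_congr rfl fun i _ => alt_perm_cons _ (hω.2 _) _ _ _)
      x y (by omega) (by omega)
  refine hw.trans ?_
  simp only [Tfun_succ]
  rw [sum4_comm]
  refine Finset.sum_congr rfl fun a _ => Finset.sum_congr rfl fun b _ => ?_
  rw [← ebasis_parseval]
  simp only [contrAny]
  rw [mul_assoc, Finset.sum_mul_sum, Finset.mul_sum]
  refine Finset.sum_congr rfl fun i _ => ?_
  rw [Finset.mul_sum]
  refine Finset.sum_congr rfl fun j _ => ?_
  simp only [mul_assoc]

lemma Eop_sum {n d m : ℕ} (v w : Evec n) (c : Fin m → ℝ) (α : Fin m → Form n d)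
    (x : Fin d → Evec n) :
    Eop v w (fun x' => ∑ b, c b * α b x') x = ∑ b, c b * Eop v w (α b) x := by
  cases d with
  | zero => simp [Eop_zero]
  | succ d =>
    simp only [Eop_succ, Finset.mul_sum]
    rw [Finset.sum_comm]
    exact Finset.sum_congr rfl fun _ _ => Finset.sum_congr rfl fun _ _ => by ring

lemma wedgeC_cons_Eop {n d : ℕ} (v w : Evec n) (α : Form n d) (x : Fin d → Evec n) :
    wedgeC (fun u => ⟪v, u⟫) α (Fin.cons w x) = ⟪v, w⟫ * α x - Eop v w α x := by
  cases d with
  | zero => rw [wedgeC_cons_zero, Eop_zero]; simp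
  | succ d => rw [wedgeC_cons]; rfl

lemma bianchi_value {n p q : ℕ} (ω : DF n p q) (hω : IsDF ω) (x : Fin p → Evec n)
    (y : Fin q → Evec n) :
    embDF ((p + 1) - 1) ((q - 1) + 1) (bianchiAdjT (bianchiT ω)) p q x y
      = q * ω x y - ∑ i, ∑ j, Tfun ω x y i j j i := by
  rcases q with _ | q
  · have h1 : bianchiT ω = 0 := rfl
    have h2 : bianchiAdjT (0 : DF n (p + 1) (0 - 1)) = 0 := by
      funext x y
      simp [bianchiAdjT]
    rw [h1, h2, embDF_zero]
    simp [Tfun_q0]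
  have h0 : embDF ((p + 1) - 1) ((q + 1 - 1) + 1) (bianchiAdjT (bianchiT ω)) p (q + 1) x y
      = ∑ i, ∑ b : Fin (q + 1), (-1 : ℝ) ^ (b : ℕ) * ⟪ebasis n i, y b⟫ *
        ∑ j, wedgeC (fun u => ⟪ebasis n j, u⟫)
          (fun x' => ω x' (Fin.cons (ebasis n j) (y ∘ b.succAbove))) (Fin.cons (ebasis n i) x) :=
    congrFun (congrFun (embDF_self (p := p) (q := q + 1) (bianchiAdjT (bianchiT ω))) x) y
  rw [h0]
  simp only [wedgeC_cons_Eop, Finset.sum_sub_distrib, mul_sub, ebasis_inner]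
  congr 1
  · rw [← Eop_trace (ω x) (hω.2 x) y]
    simp only [Eop_succ]
    refine Finset.sum_congr rfl fun i _ => Finset.sum_congr rfl fun b _ => ?_
    simp
  · rw [Finset.sum_comm (f := fun i j => Tfun ω x y i j j i)]
    refine Finset.sum_congr rfl fun i _ => ?_
    simp only [Finset.mul_sum]
    rw [Finset.sum_comm]
    refine Finset.sum_congr rfl fun j _ => ?_
    simp only [Tfun, Eop_succ]
    exact (Eop_sum _ _ (fun b : Fin (q + 1) => (-1 : ℝ) ^ (b : ℕ) * ⟪ebasis n i, y b⟫)
      (fun b x' => ω x' (Fin.cons (ebasis n j) (y ∘ b.succAbove))) x).symm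

/-- For a `(p,q)` double form `ω`:
`(1/2) g² # ω = 4 g·(c ω) − 4q ω + 4 𝔖̃ 𝔖 ω`. -/
theorem statement17 (n p q : ℕ) (ω : DF n p q) (hω : IsDF ω) :
    (2 : ℝ)⁻¹ • sharpR (gpow n 2) (embDF p q ω) =
      (4 : ℝ) • embDF (1 + (p - 1)) (1 + (q - 1)) (wedge (gdf n) (contrAny ω))
        - (4 * (q : ℝ)) • embDF p q ω
        + (4 : ℝ) • embDF ((p + 1) - 1) ((q - 1) + 1) (bianchiAdjT (bianchiT ω)) := by
  funext p' q' x y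
  rw [sharp_value _ (isDF_emb ω hω)]
  simp only [Pi.add_apply, Pi.sub_apply, Pi.smul_apply, smul_eq_mul]
  by_cases hh : p' = p ∧ q' = q
  · obtain ⟨rfl, rfl⟩ := hh
    rw [gc_value ω hω, bianchi_value ω hω, embDF_self]
    ring
  · rw [embDF_ne ω hh]
    have h1 : embDF (1 + (p - 1)) (1 + (q - 1)) (wedge (gdf n) (contrAny ω)) p' q' = 0 := by
      have wz : ∀ {p q : ℕ}, wedge (gdf n) (0 : DF n p q) = 0 := by
        intro p q; funext x y; simp [wedge]
      rcases p with _ | p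
      · have : contrAny ω = 0 := by cases q <;> rfl
        rw [this, wz, embDF_zero]; rfl
      rcases q with _ | q
      · have : contrAny ω = 0 := rfl
        rw [this, wz, embDF_zero]; rfl
      exact embDF_ne _ (by omega)
    have h2 : embDF ((p + 1) - 1) ((q - 1) + 1) (bianchiAdjT (bianchiT ω)) p' q' = 0 := by
      rcases q with _ | q
      · have h1 : bianchiT ω = 0 := rfl
        have h2 : bianchiAdjT (0 : DF n (p + 1) (0 - 1)) = 0 := by
          funext x y
          simp [bianchiAdjT]
        rw [h1, h2, embDF_zero]; rfl
      exact embDF_ne _ (by omega)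
    rw [h1, h2]
    simp [Tfun_zero]
end
end

section
/- Let E ∈ Λ²V* be a unit 2-form of rank 2r on a Euclidean n-space, and B = −(g^{p−1}ρ(E)/(p−1)!) ∘ (g^{p−1}ρ(E)/(p−1)!) the (p,p) double form. Then B is symmetric, nonnegative as a quadratic form on ΛᵖV, and B ≤ min{p,r} · gᵖ/p! (i.e. min{p,r}·gᵖ/p! − B is a nonnegative quadratic form on ΛᵖV). -/
noncomputable section

open Finset
open scoped RealInnerProductSpace

section MatrixLemmas
open Matrix

/-- The sum of row-replacement determinants is a trace against the adjugate. -/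
lemma sum_det_updateRow {R : Type*} [CommRing R] {p : ℕ} (G H : Matrix (Fin p) (Fin p) R) :
    ∑ k, (G.updateRow k (H k)).det = (H * G.adjugate).trace := by
  simp only [Matrix.trace, Matrix.diag, Matrix.mul_apply]
  refine Finset.sum_congr rfl fun k _ => ?_
  rw [← Matrix.cramer_transpose_apply, Matrix.cramer_eq_adjugate_mulVec,
    ← Matrix.adjugate_transpose]
  simp [Matrix.mulVec, dotProduct, mul_comm]

lemma sum_det_updateRow_mul {R : Type*} [CommRing R] {p : ℕ} (G D : Matrix (Fin p) (Fin p) R) :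
    ∑ k, (G.updateRow k ((G * D) k)).det = D.trace * G.det := by
  rw [sum_det_updateRow, Matrix.mul_assoc, Matrix.trace_mul_comm, Matrix.mul_assoc,
    Matrix.adjugate_mul]
  simp [mul_comm]

/-- Expansion of the determinant of a product of rectangular matrices. -/
lemma det_mul_rect {R : Type*} [CommRing R] {p n : ℕ} (Z : Matrix (Fin p) (Fin n) R)
    (W : Matrix (Fin n) (Fin p) R) :
    (Z * W).det = ∑ g : Fin p → Fin n, (Z.submatrix id g).det * ∏ i, W (g i) i := by
  simp only [Matrix.det_apply', Matrix.mul_apply, Finset.prod_univ_sum, Finset.sum_mul,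
    Finset.mul_sum, Fintype.piFinset_univ]
  rw [Finset.sum_comm]
  refine Finset.sum_congr rfl fun g _ => Finset.sum_congr rfl fun σ _ => ?_
  rw [Finset.prod_mul_distrib]
  simp [mul_assoc]

/-- Cauchy–Binet, summing over all tuples. -/
lemma cauchy_binet {R : Type*} [CommRing R] {p n : ℕ} (Z : Matrix (Fin p) (Fin n) R)
    (W : Matrix (Fin n) (Fin p) R) :
    ∑ g : Fin p → Fin n, (Z.submatrix id g).det * (W.submatrix g id).det
      = (p.factorial : R) * (Z * W).det := by
  have h : ∀ ρ : Equiv.Perm (Fin p), ∑ g : Fin p → Fin n, (Z.submatrix id g).det *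
      (((Equiv.Perm.sign ρ : ℤ) : R) * ∏ i, W (g (ρ i)) i) = (Z * W).det := by
    intro ρ
    rw [det_mul_rect]
    refine Fintype.sum_equiv (Equiv.arrowCongr ρ.symm (Equiv.refl _)) _ _ fun g => ?_
    have h2 : (Z.submatrix id (Equiv.arrowCongr ρ.symm (Equiv.refl (Fin n)) g)).det
        = ((Equiv.Perm.sign ρ : ℤ) : R) * (Z.submatrix id g).det := by
      rw [← Matrix.det_permute']
      rfl
    rw [h2]
    simp only [Equiv.arrowCongr_apply, Function.comp, Equiv.symm_symm, Equiv.refl_apply]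
    ring
  calc _ = ∑ g : Fin p → Fin n, ∑ ρ : Equiv.Perm (Fin p), (Z.submatrix id g).det *
      (((Equiv.Perm.sign ρ : ℤ) : R) * ∏ i, W (g (ρ i)) i) := by
        refine Finset.sum_congr rfl fun g _ => ?_
        rw [Matrix.det_apply' (W.submatrix g id), Finset.mul_sum]
        rfl
    _ = _ := by
        rw [Finset.sum_comm, Finset.sum_congr rfl fun ρ _ => h ρ]
        simp [Fintype.card_perm]

lemma sum_perm_apply_natAdd {q : ℕ} (F : Fin (q + 1) → ℝ) :
    ∑ σ : Equiv.Perm (Fin (q + 1)), F (σ (Fin.natAdd q 0)) = q.factorial * ∑ k, F k := by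
  have h0 : ∑ σ : Equiv.Perm (Fin (q + 1)), F (σ (Fin.natAdd q 0)) =
      ∑ σ : Equiv.Perm (Fin (q + 1)), F (σ 0) := by
    refine Fintype.sum_equiv (Equiv.mulRight (Equiv.swap 0 (Fin.natAdd q 0))) _ _ fun σ => ?_
    simp
  rw [h0, ← Equiv.sum_comp (Equiv.Perm.decomposeFin (n := q)).symm, Fintype.sum_prod_type]
  simp [Fintype.card_perm, Finset.mul_sum]

/-- Extension of a permutation of `Fin q` to `Fin (q+1)` fixing the last point. -/
def extPerm {q : ℕ} (ρ : Equiv.Perm (Fin q)) : Equiv.Perm (Fin (q + 1)) :=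
  finSumFinEquiv.permCongr (Equiv.Perm.sumCongr ρ (1 : Equiv.Perm (Fin 1)))

lemma extPerm_castAdd {q : ℕ} (ρ : Equiv.Perm (Fin q)) (i : Fin q) :
    extPerm ρ (Fin.castAdd 1 i) = Fin.castAdd 1 (ρ i) := by
  simp only [extPerm, Equiv.permCongr_apply, finSumFinEquiv_symm_apply_castAdd,
    Equiv.Perm.sumCongr_apply, Sum.map_inl, finSumFinEquiv_apply_left]

lemma extPerm_natAdd {q : ℕ} (ρ : Equiv.Perm (Fin q)) :
    extPerm ρ (Fin.natAdd q (0 : Fin 1)) = Fin.natAdd q 0 := by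
  simp only [extPerm, Equiv.permCongr_apply, finSumFinEquiv_symm_apply_natAdd,
    Equiv.Perm.sumCongr_apply, Sum.map_inr, finSumFinEquiv_apply_right, Equiv.Perm.coe_one, id]

lemma sign_extPerm {q : ℕ} (ρ : Equiv.Perm (Fin q)) :
    Equiv.Perm.sign (extPerm ρ) = Equiv.Perm.sign ρ := by
  rw [extPerm, Equiv.Perm.sign_permCongr, Equiv.Perm.sign_sumCongr]
  simp

lemma wedge_sum_aux {q : ℕ} (G H : Matrix (Fin (q + 1)) (Fin (q + 1)) ℝ)
    (σ : Equiv.Perm (Fin (q + 1))) :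
    ∑ τ : Equiv.Perm (Fin (q + 1)), ((Equiv.Perm.sign τ : ℤ) : ℝ) *
      (Matrix.of fun i j : Fin q => G (σ (Fin.castAdd 1 i)) (τ (Fin.castAdd 1 j))).det *
        H (σ (Fin.natAdd q 0)) (τ (Fin.natAdd q 0))
      = q.factorial * (((Equiv.Perm.sign σ : ℤ) : ℝ) *
        (G.updateRow (σ (Fin.natAdd q 0)) (H (σ (Fin.natAdd q 0)))).det) := by
  set N := (G.updateRow (σ (Fin.natAdd q 0)) (H (σ (Fin.natAdd q 0)))) with hN
  have hdet : ((Equiv.Perm.sign σ : ℤ) : ℝ) * N.det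
      = ∑ τ : Equiv.Perm (Fin (q + 1)), ((Equiv.Perm.sign τ : ℤ) : ℝ) *
        ((∏ i : Fin q, G (σ (Fin.castAdd 1 i)) (τ (Fin.castAdd 1 i))) *
          H (σ (Fin.natAdd q 0)) (τ (Fin.natAdd q 0))) := by
    rw [← Matrix.det_permute, ← Matrix.det_transpose, Matrix.det_apply']
    refine Finset.sum_congr rfl fun τ _ => ?_
    congr 1
    rw [Fin.prod_univ_add]
    congr 1
    · refine Finset.prod_congr rfl fun i _ => ?_
      have : σ (Fin.castAdd 1 i) ≠ σ (Fin.natAdd q 0) := by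
        intro h
        have h3 := congrArg Fin.val (σ.injective h)
        have := i.2
        simp at h3
        omega
      simp [hN, Matrix.updateRow_ne this]
    · simp [hN]
  have hρ : ∀ ρ : Equiv.Perm (Fin q), ∑ τ : Equiv.Perm (Fin (q + 1)),
      ((Equiv.Perm.sign τ : ℤ) : ℝ) * (((Equiv.Perm.sign ρ : ℤ) : ℝ) *
        ∏ i : Fin q, G (σ (Fin.castAdd 1 i)) (τ (Fin.castAdd 1 (ρ i)))) *
          H (σ (Fin.natAdd q 0)) (τ (Fin.natAdd q 0)) = ((Equiv.Perm.sign σ : ℤ) : ℝ) * N.det := by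
    intro ρ
    rw [hdet]
    refine Fintype.sum_equiv (Equiv.mulRight (extPerm ρ)) _ _ fun τ => ?_
    simp only [Equiv.coe_mulRight, Equiv.Perm.coe_mul, Function.comp, extPerm_castAdd,
      extPerm_natAdd, Equiv.Perm.sign_mul, sign_extPerm]
    push_cast
    ring
  calc _ = ∑ τ : Equiv.Perm (Fin (q + 1)), ∑ ρ : Equiv.Perm (Fin q),
      ((Equiv.Perm.sign τ : ℤ) : ℝ) * (((Equiv.Perm.sign ρ : ℤ) : ℝ) *
        ∏ i : Fin q, G (σ (Fin.castAdd 1 i)) (τ (Fin.castAdd 1 (ρ i)))) *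
          H (σ (Fin.natAdd q 0)) (τ (Fin.natAdd q 0)) := by
        refine Finset.sum_congr rfl fun τ _ => ?_
        rw [← Matrix.det_transpose, Matrix.det_apply', Finset.mul_sum, Finset.sum_mul]
        rfl
    _ = _ := by
        rw [Finset.sum_comm, Finset.sum_congr rfl fun ρ _ => hρ ρ]
        simp [Fintype.card_perm]

lemma wedge_sum {q : ℕ} (G H : Matrix (Fin (q + 1)) (Fin (q + 1)) ℝ) :
    ∑ σ : Equiv.Perm (Fin (q + 1)), ∑ τ : Equiv.Perm (Fin (q + 1)),
      ((Equiv.Perm.sign σ : ℤ) : ℝ) * ((Equiv.Perm.sign τ : ℤ) : ℝ) *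
      (Matrix.of fun i j : Fin q => G (σ (Fin.castAdd 1 i)) (τ (Fin.castAdd 1 j))).det *
        H (σ (Fin.natAdd q 0)) (τ (Fin.natAdd q 0))
      = q.factorial * (q.factorial * ∑ k, (G.updateRow k (H k)).det) := by
  rw [← sum_perm_apply_natAdd, Finset.mul_sum]
  refine Finset.sum_congr rfl fun σ _ => ?_
  have h := congrArg (fun t => ((Equiv.Perm.sign σ : ℤ) : ℝ) * t) (wedge_sum_aux G H σ)
  simp only [Finset.mul_sum] at h
  have hs : ((Equiv.Perm.sign σ : ℤ) : ℝ) * ((Equiv.Perm.sign σ : ℤ) : ℝ) = 1 := by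
    rcases Int.units_eq_one_or (Equiv.Perm.sign σ) with h | h <;> simp [h]
  calc _ = _ := by
        refine Finset.sum_congr rfl fun τ _ => ?_
        rw [mul_assoc, mul_assoc, ← mul_assoc _ (Matrix.det _)]
    _ = _ := h
    _ = _ := by linear_combination ((q.factorial : ℝ) *
        (G.updateRow (σ (Fin.natAdd q 0)) (H (σ (Fin.natAdd q 0)))).det) * hs

end MatrixLemmas

/-- The Gram matrix of a bilinear function on two tuples. -/
def gramOf {n p q : ℕ} (h : Evec n → Evec n → ℝ) (x : Fin p → Evec n) (y : Fin q → Evec n) :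
    Matrix (Fin p) (Fin q) ℝ := Matrix.of fun i j => h (x i) (y j)

lemma gpow_eq (n p : ℕ) (x y : Fin p → Evec n) :
    gpow n p x y = p.factorial * (gramOf (fun a b => ⟪a, b⟫) x y).det := by
  induction p with
  | zero => simp [gpow]
  | succ q ih =>
    have hw := wedge_sum (gramOf (fun a b => ⟪a, b⟫) x y) (gramOf (fun a b => ⟪a, b⟫) x y)
    simp only [Matrix.updateRow_eq_self] at hw
    have hq : (q.factorial : ℝ) ≠ 0 := by positivity
    calc gpow n (q + 1) x y = (((q.factorial * 1 * q.factorial * 1 : ℕ) : ℝ))⁻¹ *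
        (q.factorial * (q.factorial * (q.factorial *
          ∑ k : Fin (q + 1), (gramOf (fun a b => ⟪a, b⟫) x y).det))) := by
          rw [← hw, Finset.mul_sum]
          simp only [gpow, wedge, Nat.factorial_one]
          congr 1
          refine Finset.sum_congr rfl fun σ _ => ?_
          rw [Finset.mul_sum]
          refine Finset.sum_congr rfl fun τ _ => ?_
          rw [ih]
          simp only [gdf, gramOf, Matrix.of_apply]
          ring
      _ = _ := by
          simp [Nat.factorial_succ]
          field_simp

lemma gPowRho_eq (n p : ℕ) (E : Evec n → Evec n → ℝ) (x y : Fin p → Evec n) :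
    gPowRho p E x y =
      ∑ k, ((gramOf (fun a b => ⟪a, b⟫) x y).updateRow k (gramOf E x y k)).det := by
  cases p with
  | zero => simp [gPowRho]
  | succ q =>
    have hw := wedge_sum (gramOf (fun a b => ⟪a, b⟫) x y) (gramOf E x y)
    have hq : (q.factorial : ℝ) ≠ 0 := by positivity
    calc gPowRho (q + 1) E x y = (q.factorial : ℝ)⁻¹ *
        ((((q.factorial * 1 * q.factorial * 1 : ℕ) : ℝ))⁻¹ *
        (q.factorial * (q.factorial * (q.factorial *
          ∑ k : Fin (q + 1),
            ((gramOf (fun a b => ⟪a, b⟫) x y).updateRow k (gramOf E x y k)).det)))) := by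
          rw [← hw, Finset.mul_sum (s := Finset.univ) (a := (q.factorial : ℝ))]
          simp only [gPowRho, wedge, Nat.factorial_one, Pi.smul_apply, smul_eq_mul]
          congr 2
          refine Finset.sum_congr rfl fun σ _ => ?_
          rw [Finset.mul_sum]
          refine Finset.sum_congr rfl fun τ _ => ?_
          rw [gpow_eq]
          simp only [rho, gramOf, Matrix.of_apply]
          ring
      _ = _ := by
          push_cast
          field_simp

section Spectral
open Matrix

/-- One-sided bound for sums of distinct members of a family with symmetric values. -/
lemma mu_half {n r p : ℕ} (μ : Fin n → ℝ)
    (hcard : (Finset.univ.filter fun i => 0 < μ i).card ≤ r)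
    (hsum : ∑ i ∈ Finset.univ.filter (fun i => 0 < μ i), μ i ^ 2 ≤ 1)
    (g : Fin p → Fin n) (hg : Function.Injective g) :
    ∃ t : ℝ, 0 ≤ t ∧ ∑ j, μ (g j) ≤ t ∧ t ^ 2 ≤ ((min p r : ℕ) : ℝ) := by
  classical
  set S := Finset.univ.filter fun j => 0 < μ (g j) with hS
  have himg : S.image g ⊆ Finset.univ.filter fun i => 0 < μ i := by
    intro i hi
    obtain ⟨j, hj, rfl⟩ := Finset.mem_image.mp hi
    simpa [hS] using hj
  have hc : S.card ≤ min p r := by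
    refine le_min ?_ ?_
    · simpa using Finset.card_le_univ S
    · rw [← Finset.card_image_of_injective S hg]
      exact (Finset.card_le_card himg).trans hcard
  refine ⟨∑ j ∈ S, μ (g j), ?_, ?_, ?_⟩
  · exact Finset.sum_nonneg fun j hj => le_of_lt (by simpa [hS] using hj)
  · rw [hS, Finset.sum_filter]
    refine Finset.sum_le_sum fun j _ => ?_
    split_ifs with h
    · exact le_rfl
    · exact not_lt.mp h
  · have h1 : ∑ j ∈ S, μ (g j) ^ 2 ≤ 1 := by
      rw [← Finset.sum_image (f := fun i => μ i ^ 2) hg.injOn]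
      exact (Finset.sum_le_sum_of_subset_of_nonneg himg fun _ _ _ => sq_nonneg _).trans hsum
    have h2 : (S.card : ℝ) ≤ ((min p r : ℕ) : ℝ) := by exact_mod_cast hc
    calc _ ≤ (S.card : ℝ) * ∑ j ∈ S, μ (g j) ^ 2 := sq_sum_le_card_mul_sum_sq
      _ ≤ (S.card : ℝ) * 1 := by gcongr
      _ ≤ _ := by simpa using h2

lemma mu_bound {n r p : ℕ} (μ : Fin n → ℝ)
    (hsymm : Multiset.map μ Finset.univ.val = Multiset.map (fun i => -μ i) Finset.univ.val)
    (hcard : (Finset.univ.filter fun i => μ i ≠ 0).card ≤ 2 * r)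
    (hsum : ∑ i, μ i ^ 2 = 2)
    (g : Fin p → Fin n) (hg : Function.Injective g) :
    (∑ j, μ (g j)) ^ 2 ≤ ((min p r : ℕ) : ℝ) := by
  classical
  have key : ∀ F : ℝ → ℝ, ∑ i, F (μ i) = ∑ i, F (-μ i) := by
    intro F
    have := congrArg (fun s => (Multiset.map F s).sum) hsymm
    simpa [Multiset.map_map, Finset.sum, Function.comp_def] using this
  have hF1 := key fun t => if 0 < t then 1 else 0
  have hF2 := key fun t => if 0 < t then t ^ 2 else 0
  simp only [← Finset.sum_filter] at hF1 hF2
  have hcardeq : (Finset.univ.filter fun i => 0 < μ i).card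
      = (Finset.univ.filter fun i => 0 < -μ i).card := by
    simp only [Finset.sum_const, nsmul_eq_mul, mul_one] at hF1
    exact_mod_cast hF1
  have hunion : (Finset.univ.filter fun i => μ i ≠ 0)
      = (Finset.univ.filter fun i => 0 < μ i) ∪ (Finset.univ.filter fun i => 0 < -μ i) := by
    ext i
    simp only [Finset.mem_filter, Finset.mem_univ, true_and, Finset.mem_union, ne_eq, neg_pos]
    constructor
    · intro h
      exact (lt_or_gt_of_ne h).symm
    · rintro (h | h)
      · exact h.ne'
      · exact h.ne
  have hdisj : Disjoint (Finset.univ.filter fun i => 0 < μ i)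
      (Finset.univ.filter fun i => 0 < -μ i) := by
    rw [Finset.disjoint_filter]
    intro i _ h1 h2
    linarith
  have hsum' : ∑ i ∈ Finset.univ.filter (fun i => μ i ≠ 0), μ i ^ 2 = 2 := by
    rw [← hsum]
    refine Finset.sum_subset (Finset.filter_subset _ _) fun i _ hi => ?_
    have : μ i = 0 := by simpa using hi
    simp [this]
  rw [hunion, Finset.sum_union hdisj] at hsum'
  rw [hunion, Finset.card_union_of_disjoint hdisj] at hcard
  simp only [neg_sq] at hF2
  obtain ⟨t, ht0, ht1, ht2⟩ := mu_half (r := r) μ (by omega) (by linarith) g hg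
  obtain ⟨s, hs0, hs1, hs2⟩ := mu_half (r := r) (fun i => -μ i) (by omega)
    (by simp only [neg_sq]; linarith) g hg
  rw [Finset.sum_neg_distrib] at hs1
  rcases le_total 0 (∑ j, μ (g j)) with h | h
  · nlinarith
  · nlinarith

lemma spectral_skew {n r : ℕ} (A : Matrix (Fin n) (Fin n) ℝ) (hA : Aᵀ = -A)
    (hnorm : ∑ i, ∑ j, A i j ^ 2 = 2) (W : Matrix (Fin n) (Fin (2 * r)) ℝ)
    (C : Matrix (Fin (2 * r)) (Fin n) ℝ) (hWC : A = W * C) :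
    ∃ (U : Matrix (Fin n) (Fin n) ℂ) (μ : Fin n → ℝ), U * Uᴴ = 1 ∧
      A.map Complex.ofReal * U = U * Matrix.diagonal (fun j => -Complex.I * (μ j : ℂ)) ∧
      ∀ (p : ℕ) (g : Fin p → Fin n), Function.Injective g →
        (∑ j, μ (g j)) ^ 2 ≤ ((min p r : ℕ) : ℝ) := by
  set K : Matrix (Fin n) (Fin n) ℂ := Complex.I • A.map Complex.ofReal with hK
  have hAij : ∀ i j, A j i = -A i j := fun i j => congrFun (congrFun hA i) j
  have hKT : Kᵀ = -K := by
    ext i j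
    simp [hK, hAij i j]
  have hKH : K.IsHermitian := by
    ext i j
    simp [hK, hAij i j]
  set μ := hKH.eigenvalues with hμ
  set U : Matrix (Fin n) (Fin n) ℂ := (hKH.eigenvectorUnitary : Matrix (Fin n) (Fin n) ℂ) with hU
  have hUU : U * Uᴴ = 1 := Unitary.coe_mul_star_self hKH.eigenvectorUnitary
  have hUU' : Uᴴ * U = 1 := Unitary.coe_star_mul_self hKH.eigenvectorUnitary
  have hspec : K = U * Matrix.diagonal (fun j => (μ j : ℂ)) * Uᴴ := by
    have := hKH.spectral_theorem
    rw [Unitary.conjStarAlgAut_apply] at this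
    exact this
  have hKU : K * U = U * Matrix.diagonal (fun j => (μ j : ℂ)) := by
    conv_lhs => rw [hspec]
    rw [Matrix.mul_assoc, hUU', Matrix.mul_one]
  refine ⟨U, μ, hUU, ?_, ?_⟩
  · have h1 : A.map Complex.ofReal = (-Complex.I) • K := by
      rw [hK, smul_smul]
      simp
    have h2 : Matrix.diagonal (fun j => -Complex.I * (μ j : ℂ)) =
        (-Complex.I) • Matrix.diagonal (fun j => (μ j : ℂ)) := by
      ext i j
      by_cases h : i = j <;> simp [h, Matrix.diagonal]
    rw [h1, h2, Matrix.smul_mul, hKU, Matrix.mul_smul]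
  · intro p g hg
    refine mu_bound μ ?_ ?_ ?_ g hg
    · have h1 := hKH.roots_charpoly_eq_eigenvalues
      have hneg : (-K).charpoly = ∏ i, (Polynomial.X - Polynomial.C ((-μ i : ℝ) : ℂ)) := by
        have hs : -K = U * (Matrix.diagonal (fun j => ((-μ j : ℝ) : ℂ)) * Uᴴ) := by
          have h2 : Matrix.diagonal (fun j => ((-μ j : ℝ) : ℂ)) =
              -Matrix.diagonal (fun j => (μ j : ℂ)) := by
            ext i j
            by_cases h : i = j <;> simp [h, Matrix.diagonal]
          rw [h2]
          conv_lhs => rw [hspec]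
          simp only [Matrix.mul_assoc, Matrix.neg_mul, Matrix.mul_neg]
        rw [hs, Matrix.charpoly_mul_comm, Matrix.mul_assoc, hUU', Matrix.mul_one,
          Matrix.charpoly_diagonal]
      rw [← Matrix.charpoly_transpose, hKT, hneg, Polynomial.roots_prod _ _
        (Finset.prod_ne_zero_iff.mpr fun i _ => Polynomial.X_sub_C_ne_zero _)] at h1
      have h3 := congrArg (Multiset.map Complex.re) h1
      simp only [Polynomial.roots_X_sub_C, Multiset.bind_singleton, Multiset.map_map] at h3
      simpa [Function.comp_def, hμ] using h3.symm
    · have h1 := hKH.rank_eq_card_non_zero_eigs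
      have h2 : K = (Complex.I • W.map Complex.ofReal) * C.map Complex.ofReal := by
        ext i j
        simp [hK, hWC, Matrix.mul_apply, Finset.mul_sum, mul_assoc]
      have h3 : K.rank ≤ 2 * r := by
        rw [h2]
        refine (Matrix.rank_mul_le_left _ _).trans ?_
        simpa using Matrix.rank_le_width (Complex.I • W.map Complex.ofReal)
      rw [h1, Fintype.card_subtype] at h3
      exact h3
    · have h1 : (K * K).trace = ∑ i, (μ i : ℂ) ^ 2 := by
        have : K * K = U * (Matrix.diagonal (fun j => (μ j : ℂ)) *
            Matrix.diagonal (fun j => (μ j : ℂ)) * Uᴴ) := by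
          conv_lhs => rw [hspec]
          simp only [Matrix.mul_assoc]
          rw [← Matrix.mul_assoc Uᴴ U, hUU', Matrix.one_mul]
        rw [this, Matrix.trace_mul_comm, Matrix.mul_assoc, hUU', Matrix.mul_one,
          Matrix.diagonal_mul_diagonal, Matrix.trace_diagonal]
        simp [pow_two]
      have h2 : (K * K).trace = ((∑ i, ∑ j, A i j ^ 2 : ℝ) : ℂ) := by
        simp only [Matrix.trace, Matrix.diag, Matrix.mul_apply]
        push_cast
        refine Finset.sum_congr rfl fun i _ => Finset.sum_congr rfl fun j _ => ?_
        have : ((A j i : ℝ) : ℂ) = -(A i j : ℂ) := by rw [hAij i j]; simp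
        simp only [hK, Matrix.smul_apply, Matrix.map_apply, smul_eq_mul, this]
        linear_combination (-(A i j : ℂ) ^ 2) * Complex.I_mul_I
      rw [hnorm, h1] at h2
      exact_mod_cast h2

end Spectral

section Final
open Matrix

lemma unitary_sum {p n : ℕ} (U : Matrix (Fin n) (Fin n) ℂ) (hU : U * Uᴴ = 1)
    (Z Z' : Matrix (Fin p) (Fin n) ℝ) :
    ((∑ f : Fin p → Fin n, (Z.submatrix id f).det * (Z'.submatrix id f).det : ℝ) : ℂ)
      = ∑ g : Fin p → Fin n, ((Z.map Complex.ofReal * U).submatrix id g).det *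
          star ((Z'.map Complex.ofReal * U).submatrix id g).det := by
  have h1 : ∑ f : Fin p → Fin n, (Z.submatrix id f).det * (Z'.submatrix id f).det
      = (p.factorial : ℝ) * (Z * Z'ᵀ).det := by
    rw [← cauchy_binet]
    refine Finset.sum_congr rfl fun f _ => ?_
    rw [← Matrix.det_transpose (Z'.submatrix id f)]
    rfl
  have h2 : ∑ g : Fin p → Fin n, ((Z.map Complex.ofReal * U).submatrix id g).det *
          star ((Z'.map Complex.ofReal * U).submatrix id g).det
      = (p.factorial : ℂ) * (Z.map Complex.ofReal * U * (Z'.map Complex.ofReal * U)ᴴ).det := by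
    rw [← cauchy_binet]
    refine Finset.sum_congr rfl fun f _ => ?_
    rw [← Matrix.det_conjTranspose]
    rfl
  have h3 : Z.map Complex.ofReal * U * (Z'.map Complex.ofReal * U)ᴴ
      = (Z * Z'ᵀ).map Complex.ofReal := by
    rw [Matrix.conjTranspose_mul, Matrix.mul_assoc, ← Matrix.mul_assoc U, hU, Matrix.one_mul]
    ext i j
    simp [Matrix.mul_apply]
  rw [h1, h2, h3]
  push_cast
  congr 1
  exact Complex.ofRealHom.map_det (Z * Z'ᵀ)

lemma row_sum {p n : ℕ} (U : Matrix (Fin n) (Fin n) ℂ) (A : Matrix (Fin n) (Fin n) ℝ)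
    (d : Fin n → ℂ) (hAU : A.map Complex.ofReal * U = U * Matrix.diagonal d)
    (X : Matrix (Fin p) (Fin n) ℝ) (g : Fin p → Fin n) :
    ∑ k, (((X.updateRow k ((X * A) k)).map Complex.ofReal * U).submatrix id g).det
      = (∑ j, d (g j)) * ((X.map Complex.ofReal * U).submatrix id g).det := by
  have h := sum_det_updateRow_mul ((X.map Complex.ofReal * U).submatrix id g)
    (Matrix.diagonal fun j => d (g j))
  rw [Matrix.trace_diagonal] at h
  rw [← h]
  refine Finset.sum_congr rfl fun k _ => ?_
  congr 1
  have hXA : (X * A).map Complex.ofReal * U = X.map Complex.ofReal * U * Matrix.diagonal d := by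
    rw [Matrix.mul_assoc, ← hAU, ← Matrix.mul_assoc]
    congr 1
    ext i j
    simp [Matrix.mul_apply]
  ext i j
  by_cases hi : i = k
  · subst hi
    have := congrFun (congrFun hXA i) (g j)
    rw [Matrix.mul_diagonal] at this
    rw [Matrix.updateRow_self, Matrix.mul_diagonal]
    simp only [Matrix.submatrix_apply, id]
    rw [← this]
    simp only [Matrix.mul_apply (M := Matrix.map _ _), Matrix.map_apply, Matrix.updateRow_self]
  · rw [Matrix.updateRow_ne hi]
    simp only [Matrix.submatrix_apply, id, Matrix.mul_apply, Matrix.map_apply,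
      Matrix.updateRow_ne hi]

lemma quad_swap {R G ι : Type*} [CommRing R] [Fintype G] [Fintype ι] (x y : ι → R)
    (u w : ι → G → R) :
    ∑ g, (∑ a, x a * u a g) * (∑ b, y b * w b g)
      = ∑ a, ∑ b, x a * y b * ∑ g, u a g * w b g := by
  simp_rw [Finset.sum_mul_sum, Finset.mul_sum]
  rw [Finset.sum_comm]
  refine Finset.sum_congr rfl fun a _ => ?_
  rw [Finset.sum_comm]
  refine Finset.sum_congr rfl fun b _ => Finset.sum_congr rfl fun g _ => by ring

lemma quad_transfer {F G ι : Type*} [Fintype F] [Fintype G] [Fintype ι] (c : ι → ℝ)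
    (u : ι → F → ℝ) (Q : ι → G → ℂ)
    (h : ∀ a b, ((∑ f, u a f * u b f : ℝ) : ℂ) = ∑ g, Q a g * star (Q b g)) :
    ∑ f, (∑ a, c a * u a f) ^ 2 = ∑ g, Complex.normSq (∑ a, (c a : ℂ) * Q a g) := by
  have h1 : ((∑ f, (∑ a, c a * u a f) ^ 2 : ℝ) : ℂ)
      = ((∑ g, Complex.normSq (∑ a, (c a : ℂ) * Q a g) : ℝ) : ℂ) := by
    simp only [pow_two, quad_swap]
    rw [Complex.ofReal_sum, Complex.ofReal_sum]
    simp only [← Complex.mul_conj, map_sum, map_mul, Complex.conj_ofReal]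
    rw [quad_swap]
    refine Finset.sum_congr rfl fun a _ => ?_
    rw [Complex.ofReal_sum]
    refine Finset.sum_congr rfl fun b _ => ?_
    rw [Complex.ofReal_mul, h]
    simp
  exact_mod_cast h1

/-- The main inequality in matrix form. -/
lemma core_bound {p n r m : ℕ} (A : Matrix (Fin n) (Fin n) ℝ) (hA : Aᵀ = -A)
    (hnorm : ∑ i, ∑ j, A i j ^ 2 = 2) (W : Matrix (Fin n) (Fin (2 * r)) ℝ)
    (C : Matrix (Fin (2 * r)) (Fin n) ℝ) (hWC : A = W * C)
    (c : Fin m → ℝ) (X : Fin m → Matrix (Fin p) (Fin n) ℝ) :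
    ∑ f : Fin p → Fin n,
        (∑ a, c a * ∑ k, (((X a).updateRow k ((X a * A) k)).submatrix id f).det) ^ 2
      ≤ ((min p r : ℕ) : ℝ) *
        ∑ f : Fin p → Fin n, (∑ a, c a * ((X a).submatrix id f).det) ^ 2 := by
  obtain ⟨U, μ, hU, hAU, hμ⟩ := spectral_skew A hA hnorm W C hWC
  set Q : Fin m → (Fin p → Fin n) → ℂ :=
    fun a g => (((X a).map Complex.ofReal * U).submatrix id g).det with hQ
  set d : (Fin p → Fin n) → ℂ := fun g => ∑ j, -Complex.I * (μ (g j) : ℂ) with hd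
  have e1 : ∑ f : Fin p → Fin n, (∑ a, c a * ((X a).submatrix id f).det) ^ 2
      = ∑ g, Complex.normSq (∑ a, (c a : ℂ) * Q a g) :=
    quad_transfer c _ Q fun a b => unitary_sum U hU (X a) (X b)
  have e2 : ∑ f : Fin p → Fin n,
        (∑ a, c a * ∑ k, (((X a).updateRow k ((X a * A) k)).submatrix id f).det) ^ 2
      = ∑ g, Complex.normSq (∑ a, (c a : ℂ) * (d g * Q a g)) := by
    refine quad_transfer c _ (fun a g => d g * Q a g) fun a b => ?_
    simp only [hd, hQ, ← row_sum U A _ hAU, star_sum, Finset.sum_mul_sum]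
    rw [Finset.sum_comm, Finset.sum_comm (s := Finset.univ (α := Fin p → Fin n)),
      Complex.ofReal_sum]
    refine Finset.sum_congr rfl fun k _ => ?_
    rw [Finset.sum_comm, Finset.sum_comm (s := Finset.univ (α := Fin p → Fin n)),
      Complex.ofReal_sum]
    exact Finset.sum_congr rfl fun l _ => unitary_sum U hU _ _
  rw [e1, e2, Finset.mul_sum]
  refine Finset.sum_le_sum fun g _ => ?_
  have h1 : ∑ a, (c a : ℂ) * (d g * Q a g) = d g * ∑ a, (c a : ℂ) * Q a g := by
    rw [Finset.mul_sum]
    exact Finset.sum_congr rfl fun a _ => by ring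
  rw [h1, map_mul]
  by_cases hg : Function.Injective g
  · refine mul_le_mul_of_nonneg_right ?_ (Complex.normSq_nonneg _)
    have h2 : d g = -Complex.I * ((∑ j, μ (g j) : ℝ) : ℂ) := by
      simp only [hd]
      push_cast
      rw [Finset.mul_sum]
    rw [h2, map_mul, Complex.normSq_ofReal]
    simpa [pow_two] using hμ p g hg
  · have h3 : ∀ a, Q a g = 0 := by
      intro a
      rw [Function.Injective] at hg
      push Not at hg
      obtain ⟨i, j, hij, hne⟩ := hg
      exact Matrix.det_zero_of_column_eq hne fun k => by simp [hij]
    simp [h3]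

/-- Coordinates of a tuple of vectors. -/
def coordM {n p : ℕ} (x : Fin p → Evec n) : Matrix (Fin p) (Fin n) ℝ :=
  Matrix.of fun i m => x i m

lemma vec_expand {n : ℕ} (x : Evec n) : x = ∑ i, x i • ebasis n i := by
  ext j
  simp [ebasis, Finset.sum_apply, Pi.single_apply]

lemma bilin_expand {n : ℕ} (E : Evec n → Evec n → ℝ) (hE : IsBilin E) (x y : Evec n) :
    E x y = ∑ i, ∑ j, x i * E (ebasis n i) (ebasis n j) * y j := by
  have h1 : E x y = ∑ i, x i * E (ebasis n i) y := by
    have := map_sum (IsLinearMap.mk' _ (hE.1 y)) (fun i => x i • ebasis n i) Finset.univ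
    rw [← vec_expand] at this
    simpa using this
  rw [h1]
  refine Finset.sum_congr rfl fun i _ => ?_
  have := map_sum (IsLinearMap.mk' _ (hE.2 (ebasis n i))) (fun j => y j • ebasis n j) Finset.univ
  rw [← vec_expand] at this
  simp only [IsLinearMap.mk'_apply, map_smul, smul_eq_mul] at this
  rw [this, Finset.mul_sum]
  exact Finset.sum_congr rfl fun j _ => by ring

lemma gram_inner {n p q : ℕ} (x : Fin p → Evec n) (y : Fin q → Evec n) :
    gramOf (fun a b => ⟪a, b⟫) x y = coordM x * (coordM y)ᵀ := by
  ext i j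
  simp [gramOf, coordM, Matrix.mul_apply, PiLp.inner_apply, mul_comm]

lemma gram_E {n p q : ℕ} (E : Evec n → Evec n → ℝ) (hE : IsBilin E)
    (x : Fin p → Evec n) (y : Fin q → Evec n) :
    gramOf E x y = coordM x * (gramOf E (ebasis n) (ebasis n)) * (coordM y)ᵀ := by
  ext i j
  simp only [gramOf, Matrix.of_apply, Matrix.mul_apply, coordM, Matrix.transpose_apply]
  rw [bilin_expand E hE, Finset.sum_comm]
  simp only [Finset.sum_mul]

lemma coordM_ebasis {n p : ℕ} (f : Fin p → Fin n) (Z : Matrix (Fin p) (Fin n) ℝ) :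
    Z * (coordM fun i => ebasis n (f i))ᵀ = Z.submatrix id f := by
  ext i j
  simp [Matrix.mul_apply, coordM, ebasis]

lemma alt_swap_s18 {n : ℕ} (E : Evec n → Evec n → ℝ) (hE : IsAltBilin E) (x y : Evec n) :
    E y x = -E x y := by
  have h := hE.2 (x + y)
  rw [(hE.1.1 (x + y)).map_add, (hE.1.2 x).map_add, (hE.1.2 y).map_add, hE.2, hE.2] at h
  linarith

lemma gPowRho_swap {n p : ℕ} (E : Evec n → Evec n → ℝ) (hE : IsAltBilin E)
    (x y : Fin p → Evec n) : gPowRho p E y x = -gPowRho p E x y := by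
  rw [gPowRho_eq, gPowRho_eq, sum_det_updateRow, sum_det_updateRow]
  have h1 : gramOf E y x = -(gramOf E x y)ᵀ := by
    ext i j
    simp [gramOf, alt_swap_s18 E hE (x j) (y i)]
  have h2 : gramOf (fun a b : Evec n => ⟪a, b⟫) y x = (gramOf (fun a b => ⟪a, b⟫) x y)ᵀ := by
    ext i j
    simp [gramOf, real_inner_comm]
  rw [h1, h2, ← Matrix.adjugate_transpose, Matrix.neg_mul, Matrix.trace_neg,
    ← Matrix.transpose_mul, Matrix.trace_transpose, Matrix.trace_mul_comm]

lemma neg_comp_eq {n p : ℕ} (E : Evec n → Evec n → ℝ) (hE : IsAltBilin E)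
    (x y : Fin p → Evec n) : (-(comp (gPowRho p E) (gPowRho p E))) x y
      = (p.factorial : ℝ)⁻¹ * ∑ f : Fin p → Fin n,
        gPowRho p E x (fun i => ebasis n (f i)) * gPowRho p E y (fun i => ebasis n (f i)) := by
  change -(comp (gPowRho p E) (gPowRho p E) x y) = _
  rw [_root_.comp, ← mul_neg, ← Finset.sum_neg_distrib]
  congr 1
  refine Finset.sum_congr rfl fun f _ => ?_
  rw [gPowRho_swap E hE y]
  ring

lemma quad_comp_eq {n p m : ℕ} (E : Evec n → Evec n → ℝ) (hE : IsAltBilin E)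
    (c : Fin m → ℝ) (v : Fin m → (Fin p → Evec n)) :
    ∑ a, ∑ b, c a * c b * (-(comp (gPowRho p E) (gPowRho p E))) (v a) (v b)
      = (p.factorial : ℝ)⁻¹ * ∑ f : Fin p → Fin n,
        (∑ a, c a * gPowRho p E (v a) (fun i => ebasis n (f i))) ^ 2 := by
  simp only [neg_comp_eq E hE, pow_two]
  rw [quad_swap, Finset.mul_sum]
  refine Finset.sum_congr rfl fun a _ => ?_
  rw [Finset.mul_sum]
  exact Finset.sum_congr rfl fun b _ => by ring

lemma quad_gpow_eq {n p m : ℕ} (c : Fin m → ℝ) (v : Fin m → (Fin p → Evec n)) :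
    ∑ a, ∑ b, c a * c b * gpow n p (v a) (v b)
      = ∑ f : Fin p → Fin n, (∑ a, c a * ((coordM (v a)).submatrix id f).det) ^ 2 := by
  simp only [pow_two]
  rw [quad_swap]
  refine Finset.sum_congr rfl fun a _ => Finset.sum_congr rfl fun b _ => ?_
  rw [gpow_eq, gram_inner, ← cauchy_binet]
  congr 1
  refine Finset.sum_congr rfl fun f _ => ?_
  rw [← Matrix.det_transpose ((coordM (v b)).submatrix id f)]
  rfl

lemma gPowRho_ebasis {n p : ℕ} (E : Evec n → Evec n → ℝ) (hE : IsBilin E)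
    (x : Fin p → Evec n) (f : Fin p → Fin n) :
    gPowRho p E x (fun i => ebasis n (f i)) = ∑ k, (((coordM x).updateRow k
      ((coordM x * gramOf E (ebasis n) (ebasis n)) k)).submatrix id f).det := by
  rw [gPowRho_eq, gram_inner, gram_E E hE, coordM_ebasis, coordM_ebasis]
  refine Finset.sum_congr rfl fun k _ => ?_
  congr 1
  ext i j
  by_cases hi : i = k
  · subst hi
    simp
  · simp [Matrix.updateRow_ne hi]

end Final

/-- Let `E` be a unit 2-form of rank `2r` and
`B = −(g^{p−1}ρ(E)/(p−1)!)∘(g^{p−1}ρ(E)/(p−1)!)`. Then `B` is symmetric, nonnegative as a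
quadratic form on `ΛᵖV`, and `B ≤ min{p,r}·gᵖ/p!` as quadratic forms on `ΛᵖV`. -/
theorem statement18 (n p r : ℕ) (E : Evec n → Evec n → ℝ) (hE : IsAltBilin E)
    (hunit : inner2 E E = 1)
    (hrank : ExprBy E (2 * r) ∧ ∀ m, ExprBy E m → 2 * r ≤ m) :
    transp (-(comp (gPowRho p E) (gPowRho p E))) = -(comp (gPowRho p E) (gPowRho p E)) ∧
    (∀ (m : ℕ) (c : Fin m → ℝ) (v : Fin m → (Fin p → Evec n)),
      0 ≤ ∑ a, ∑ b, c a * c b * (-(comp (gPowRho p E) (gPowRho p E))) (v a) (v b)) ∧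
    (∀ (m : ℕ) (c : Fin m → ℝ) (v : Fin m → (Fin p → Evec n)),
      (∑ a, ∑ b, c a * c b * (-(comp (gPowRho p E) (gPowRho p E))) (v a) (v b)) ≤
        ((min p r : ℕ) : ℝ) *
          (((p.factorial : ℝ))⁻¹ * ∑ a, ∑ b, c a * c b * gpow n p (v a) (v b))) := by
  refine ⟨?_, ?_, ?_⟩
  · funext x y
    rw [transp, neg_comp_eq E hE, neg_comp_eq E hE]
    congr 1
    exact Finset.sum_congr rfl fun f _ => mul_comm _ _
  · intro m c v
    rw [quad_comp_eq E hE]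
    positivity
  · intro m c v
    obtain ⟨⟨w, κ, hw⟩, -⟩ := hrank
    have hb := core_bound (p := p) (r := r) (gramOf E (ebasis n) (ebasis n))
      (by
        ext i j
        simp [gramOf, alt_swap_s18 E hE (ebasis n i) (ebasis n j)])
      (by
        simp only [inner2] at hunit
        simp only [gramOf, Matrix.of_apply, pow_two]
        linarith)
      (Matrix.of fun i a => w a i)
      (Matrix.of fun a j => ∑ b, (κ a b - κ b a) * w b j)
      (by
        ext i j
        have hin : ∀ (u : Evec n) (k : Fin n), ⟪u, ebasis n k⟫ = u k := by
          intro u k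
          simp [ebasis, EuclideanSpace.inner_single_right]
        simp only [gramOf, Matrix.of_apply, Matrix.mul_apply, hw, hin]
        simp only [mul_sub, sub_mul, Finset.sum_sub_distrib, Finset.mul_sum]
        congr 1
        · exact Finset.sum_congr rfl fun a _ => Finset.sum_congr rfl fun b _ => by ring
        · rw [Finset.sum_comm]
          exact Finset.sum_congr rfl fun a _ => Finset.sum_congr rfl fun b _ => by ring)
      c (fun a => coordM (v a))
    rw [quad_comp_eq E hE, quad_gpow_eq, mul_left_comm]
    refine mul_le_mul_of_nonneg_left ?_ (by positivity)
    simpa only [gPowRho_ebasis E hE.1] using hb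
end
end
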